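/- Let d = 4 and define ω : ℝ⁴ → ℝ by ω(ξ) = √(1 + Σ_{j=1}^{4} 2(1 − cos ξ_j)). For t ∈ ℝ and x ∈ ℤ⁴, let I(t,x) = ∫_{[0,2π]⁴} e^{i(x·ξ − t ω(ξ))} a(ξ) dξ, where the amplitude is a(ξ) = 1 or a(ξ) = 1/ω(ξ). Then there exists a constant C > 0, independent of t, such that sup_{x ∈ ℤ⁴} |I(t,x)| ≤ C(1 + |t|)^{-3/2} log(2 + |t|) for all t ∈ ℝ. -/

import Mathlib

open MeasureTheory Real
open scoped ENNReal

noncomputable section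

/-- Dispersion relation of the discrete Klein--Gordon equation on `ℤ^d`. -/
def omegaKG (d : ℕ) (ξ : Fin d → ℝ) : ℝ :=
  Real.sqrt (1 + ∑ j : Fin d, 2 * (1 - Real.cos (ξ j)))

/-- The fundamental domain `[0, 2π]^d` of the torus. -/
def cube (d : ℕ) : Set (Fin d → ℝ) := Set.Icc 0 (fun _ => 2 * Real.pi)

/-- The oscillatory integral `I(t,x) = ∫_{[0,2π]^d} e^{i(x·ξ − t ω(ξ))} a(ξ) dξ`. -/
def oscInt (d : ℕ) (a : (Fin d → ℝ) → ℂ) (t : ℝ) (x : Fin d → ℤ) : ℂ :=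
  ∫ ξ in cube d,
    Complex.exp (Complex.I * (((∑ j : Fin d, (x j : ℝ) * ξ j) - t * omegaKG d ξ : ℝ) : ℂ)) * a ξ

/-- Van der Corput's first derivative test with an amplitude of bounded variation. -/
theorem norm_integral_amplitude_mul_exp_le {a b μ : ℝ} (hab : a ≤ b) (hμ : 0 < μ)
    {φ φ' φ'' ψ ψ' : ℝ → ℝ} (hφ : ∀ x, HasDerivAt φ (φ' x) x)
    (hφ' : ∀ x, HasDerivAt φ' (φ'' x) x) (hψ : ∀ x, HasDerivAt ψ (ψ' x) x)
    (hφc : Continuous φ'') (hψc : Continuous ψ')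
    (hneg : ∀ x ∈ Set.Icc a b, φ'' x ≤ 0) (hlow : ∀ x ∈ Set.Icc a b, μ ≤ |φ' x|)
    (hψ1 : ∀ x ∈ Set.Icc a b, |ψ x| ≤ 1) (hV : ∫ x in a..b, |ψ' x| ≤ 1) :
    ‖∫ x in a..b, (ψ x : ℂ) * Complex.exp (φ x * Complex.I)‖ ≤ 5 / μ := by
  have hu : Set.uIcc a b = Set.Icc a b := Set.uIcc_of_le hab
  have hφcont : Continuous φ := continuous_iff_continuousAt.2 fun x => (hφ x).continuousAt
  have hφ'cont : Continuous φ' := continuous_iff_continuousAt.2 fun x => (hφ' x).continuousAt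
  have hψcont : Continuous ψ := continuous_iff_continuousAt.2 fun x => (hψ x).continuousAt
  have hne : ∀ x ∈ Set.Icc a b, φ' x ≠ 0 := fun x hx h => by
    have := hlow x hx; rw [h, abs_zero] at this; linarith
  have hinv : ∀ x ∈ Set.Icc a b, |(φ' x)⁻¹| ≤ 1 / μ := fun x hx => by
    rw [abs_inv, ← one_div]; exact one_div_le_one_div_of_le hμ (hlow x hx)
  -- the amplitude divided by the derivative of the phase
  have hq : ∀ x ∈ Set.Icc a b, HasDerivAt (fun x => ψ x * (φ' x)⁻¹)
      (ψ' x * (φ' x)⁻¹ + ψ x * (-φ'' x / φ' x ^ 2)) x := fun x hx =>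
    (hψ x).mul ((hφ' x).inv (hne x hx))
  have hq1 : ContinuousOn (fun x => -φ'' x / φ' x ^ 2) (Set.Icc a b) :=
    ContinuousOn.div (by fun_prop) (by fun_prop) fun x hx => pow_ne_zero _ (hne x hx)
  have hi : ContinuousOn (fun x => (φ' x)⁻¹) (Set.Icc a b) :=
    ContinuousOn.inv₀ (by fun_prop) hne
  have hqc : ContinuousOn (fun x => ψ' x * (φ' x)⁻¹ + ψ x * (-φ'' x / φ' x ^ 2))
      (Set.Icc a b) := by
    exact (hψc.continuousOn.mul hi).add (hψcont.continuousOn.mul hq1)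
  have hparts := intervalIntegral.integral_mul_deriv_eq_deriv_mul (a := a) (b := b)
    (u := fun x => ((ψ x * (φ' x)⁻¹ : ℝ) : ℂ))
    (u' := fun x => ((ψ' x * (φ' x)⁻¹ + ψ x * (-φ'' x / φ' x ^ 2) : ℝ) : ℂ))
    (v := fun x => -Complex.I * Complex.exp (φ x * Complex.I))
    (v' := fun x => (φ' x : ℂ) * Complex.exp (φ x * Complex.I))
    (fun x hx => (hq x (hu ▸ hx)).ofReal_comp)
    (fun x _ => by
      have h := (((hφ x).ofReal_comp.mul_const Complex.I).cexp).const_mul (-Complex.I)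
      refine h.congr_deriv ?_
      linear_combination (-(φ' x : ℂ) * Complex.exp (φ x * Complex.I)) * Complex.I_mul_I)
    (ContinuousOn.intervalIntegrable (by
      rw [hu]; exact Complex.continuous_ofReal.comp_continuousOn hqc))
    (Continuous.intervalIntegrable (by fun_prop) _ _)
  have hleft : ∫ x in a..b, (ψ x : ℂ) * Complex.exp (φ x * Complex.I) =
      ∫ x in a..b, ((ψ x * (φ' x)⁻¹ : ℝ) : ℂ) *
        ((φ' x : ℂ) * Complex.exp (φ x * Complex.I)) := by
    refine intervalIntegral.integral_congr fun x hx => ?_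
    have : (φ' x : ℂ) ≠ 0 := by exact_mod_cast hne x (hu ▸ hx)
    push_cast
    field_simp
  rw [hleft, hparts]
  have hexp : ∀ x, ‖-Complex.I * Complex.exp (φ x * Complex.I)‖ = 1 := fun x => by
    simp [Complex.norm_exp_ofReal_mul_I]
  have hbd : ∀ x ∈ Set.Icc a b,
      ‖((ψ x * (φ' x)⁻¹ : ℝ) : ℂ) * (-Complex.I * Complex.exp (φ x * Complex.I))‖ ≤ 1 / μ := by
    intro x hx
    rw [norm_mul, hexp, mul_one, Complex.norm_real, Real.norm_eq_abs, abs_mul]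
    calc _ ≤ 1 * (1 / μ) := mul_le_mul (hψ1 x hx) (hinv x hx) (abs_nonneg _) zero_le_one
      _ = _ := one_mul _
  have hint : ‖∫ x in a..b, ((ψ' x * (φ' x)⁻¹ + ψ x * (-φ'' x / φ' x ^ 2) : ℝ) : ℂ) *
      (-Complex.I * Complex.exp (φ x * Complex.I))‖ ≤ 3 / μ := by
    have h1 : IntervalIntegrable (fun x => |ψ' x| * (1 / μ)) volume a b :=
      Continuous.intervalIntegrable (by fun_prop) _ _
    have h2 : IntervalIntegrable (fun x => -φ'' x / φ' x ^ 2) volume a b :=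
      ContinuousOn.intervalIntegrable (by rwa [hu])
    have h3 : ∫ x in a..b, -φ'' x / φ' x ^ 2 = (φ' b)⁻¹ - (φ' a)⁻¹ :=
      intervalIntegral.integral_eq_sub_of_hasDerivAt
        (fun x hx => (hφ' x).inv (hne x (hu ▸ hx))) h2
    calc _ ≤ ∫ x in a..b, (|ψ' x| * (1 / μ) + -φ'' x / φ' x ^ 2) := by
          refine intervalIntegral.norm_integral_le_of_norm_le hab
            (Filter.Eventually.of_forall fun x hx => ?_) (h1.add h2)
          have hx' := Set.Ioc_subset_Icc_self hx
          rw [norm_mul, hexp, mul_one, Complex.norm_real, Real.norm_eq_abs]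
          have h0 : 0 ≤ -φ'' x / φ' x ^ 2 :=
            div_nonneg (neg_nonneg.2 (hneg x hx')) (sq_nonneg _)
          refine (abs_add_le _ _).trans (add_le_add ?_ ?_)
          · rw [abs_mul]; exact mul_le_mul_of_nonneg_left (hinv x hx') (abs_nonneg _)
          · rw [abs_mul, abs_of_nonneg h0]; exact mul_le_of_le_one_left h0 (hψ1 x hx')
      _ = (∫ x in a..b, |ψ' x|) * (1 / μ) + ((φ' b)⁻¹ - (φ' a)⁻¹) := by
          rw [intervalIntegral.integral_add h1 h2, h3, intervalIntegral.integral_mul_const]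
      _ ≤ 1 * (1 / μ) + (1 / μ + 1 / μ) := by
          have hb := hinv b (Set.right_mem_Icc.2 hab)
          have ha := hinv a (Set.left_mem_Icc.2 hab)
          have := mul_le_mul_of_nonneg_right hV (one_div_pos.2 hμ).le
          linarith [le_abs_self (φ' b)⁻¹, neg_abs_le (φ' a)⁻¹]
      _ = 3 / μ := by ring
  calc _ ≤ 1 / μ + 1 / μ + 3 / μ := by
        refine (norm_sub_le _ _).trans (add_le_add ((norm_sub_le _ _).trans
          (add_le_add (hbd b (Set.right_mem_Icc.2 hab)) (hbd a (Set.left_mem_Icc.2 hab)))) hint)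
    _ = 5 / μ := by ring

theorem sin_arcsin_le {y : ℝ} (hy : -1 ≤ y) : sin (arcsin y) ≤ y := by
  rcases le_total y 1 with h | h
  · exact (sin_arcsin hy h).le
  · exact (sin_le_one _).trans h

theorem le_sin_arcsin {y : ℝ} (hy : y ≤ 1) : y ≤ sin (arcsin y) := by
  rcases le_total (-1) y with h | h
  · exact (sin_arcsin h hy).ge
  · exact h.trans (neg_one_le_sin _)

/-- On `[0, π/2]`, the set where `|ν - 2 s sin ξ| < μ` is an interval with controlled endpoints. -/
theorem exists_sublevel_interval (ν : ℝ) {s μ : ℝ} (hs : 0 < s) (hμ : 0 < μ) :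
    ∃ α β : ℝ, 0 ≤ α ∧ α ≤ β ∧ β ≤ π / 2 ∧
      (α = 0 ∨ ∀ ξ ∈ Set.Icc 0 α, μ ≤ |ν - 2 * s * sin ξ|) ∧
      (β = π / 2 ∨ ∀ ξ ∈ Set.Icc β (π / 2), μ ≤ |ν - 2 * s * sin ξ|) ∧
      (α < β → sin β - sin α ≤ μ / s) ∧ 2 * s * sin α ≤ |ν| := by
  have hpi := pi_pos
  set y₁ := (ν - μ) / (2 * s) with hy₁
  set y₂ := (ν + μ) / (2 * s) with hy₂
  have e₁ : 2 * s * y₁ = ν - μ := by rw [hy₁]; field_simp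
  have e₂ : 2 * s * y₂ = ν + μ := by rw [hy₂]; field_simp
  have h12 : y₁ ≤ y₂ := by rw [hy₁, hy₂]; gcongr; linarith
  have hdiff : y₂ - y₁ = μ / s := by rw [hy₁, hy₂]; field_simp; ring
  have hα : 0 < arcsin y₁ → sin (arcsin y₁) ≤ y₁ := fun h =>
    sin_arcsin_le (by linarith [arcsin_pos.1 h])
  have hα' : arcsin y₁ < π / 2 → y₁ ≤ sin (arcsin y₁) := fun h =>
    le_sin_arcsin (arcsin_lt_pi_div_two.1 h).le
  have hβ : 0 < arcsin y₂ → sin (arcsin y₂) ≤ y₂ := fun h =>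
    sin_arcsin_le (by linarith [arcsin_pos.1 h])
  have hβ' : arcsin y₂ < π / 2 → y₂ ≤ sin (arcsin y₂) := fun h =>
    le_sin_arcsin (arcsin_lt_pi_div_two.1 h).le
  have hle₁ := arcsin_le_pi_div_two y₁
  have hle₂ := arcsin_le_pi_div_two y₂
  have hge₁ := neg_pi_div_two_le_arcsin y₁
  have hge₂ := neg_pi_div_two_le_arcsin y₂
  refine ⟨max 0 (arcsin y₁), max 0 (arcsin y₂), le_max_left _ _,
    max_le_max le_rfl (monotone_arcsin h12), max_le (by positivity) hle₂, ?_, ?_, ?_, ?_⟩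
  · rcases le_or_gt (arcsin y₁) 0 with h | h
    · exact Or.inl (max_eq_left h)
    · right
      rw [max_eq_right h.le]
      intro ξ hξ
      have h1 : sin ξ ≤ sin (arcsin y₁) :=
        sin_le_sin_of_le_of_le_pi_div_two (by linarith [hξ.1]) hle₁ hξ.2
      have h2 := mul_le_mul_of_nonneg_left (h1.trans (hα h)) (by positivity : 0 ≤ 2 * s)
      exact le_trans (by linarith) (le_abs_self _)
  · rcases le_or_gt (π / 2) (arcsin y₂) with h | h
    · left
      rw [le_antisymm hle₂ h]; exact max_eq_right (by positivity)
    · right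
      intro ξ hξ
      have h1 : sin (arcsin y₂) ≤ sin ξ :=
        sin_le_sin_of_le_of_le_pi_div_two hge₂ hξ.2 ((le_max_right _ _).trans hξ.1)
      have h2 := mul_le_mul_of_nonneg_left ((hβ' h).trans h1) (by positivity : 0 ≤ 2 * s)
      exact le_trans (by linarith) (neg_le_abs _)
  · intro hlt
    have hb : 0 < arcsin y₂ := by
      by_contra! h
      rw [max_eq_left h] at hlt
      exact absurd (le_max_left _ _) (not_le.2 hlt)
    rw [max_eq_right hb.le] at hlt ⊢
    have ha : arcsin y₁ < π / 2 := (le_max_right _ _).trans_lt (hlt.trans_le hle₂)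
    have h1 : sin (arcsin y₁) ≤ sin (max 0 (arcsin y₁)) :=
      sin_le_sin_of_le_of_le_pi_div_two hge₁ (max_le (by positivity) hle₁) (le_max_right _ _)
    linarith [hα' ha, hβ hb]
  · rcases le_or_gt (arcsin y₁) 0 with h | h
    · rw [max_eq_left h, sin_zero, mul_zero]; exact abs_nonneg _
    · rw [max_eq_right h.le]
      have := mul_le_mul_of_nonneg_left (hα h) (by positivity : 0 ≤ 2 * s)
      linarith [le_abs_self ν]

/-- Lower bounds for the increment of the sine on `[0, π/2]`. -/
theorem sin_sub_sin_lower {α β : ℝ} (hα : 0 ≤ α) (hαβ : α ≤ β) (hβ : β ≤ π / 2) :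
    2 * ((β - α) / π) ^ 2 ≤ sin β - sin α ∧ (β - α) / π * cos α ≤ sin β - sin α := by
  have hpi := pi_pos
  have hL : 0 ≤ (β - α) / π := div_nonneg (by linarith) hpi.le
  have h1 : (β - α) / π ≤ sin ((β - α) / 2) := by
    have := mul_le_sin (x := (β - α) / 2) (by linarith) (by linarith)
    calc (β - α) / π = 2 / π * ((β - α) / 2) := by field_simp
      _ ≤ _ := this
  have h2 : sin ((β - α) / 2) ≤ cos ((β + α) / 2) := by
    rw [← cos_pi_div_two_sub]
    exact cos_le_cos_of_nonneg_of_le_pi (by linarith) (by linarith) (by linarith)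
  have h3 : cos α ≤ 2 * cos ((β + α) / 2) := by
    have h := cos_add_cos β α
    have hb : 0 ≤ cos β := cos_nonneg_of_neg_pi_div_two_le_of_le (by linarith) hβ
    nlinarith [cos_le_one ((β - α) / 2), (hL.trans h1).trans h2]
  rw [sin_sub_sin]
  constructor
  · nlinarith
  · nlinarith [mul_le_mul h1 h3 (cos_nonneg_of_neg_pi_div_two_le_of_le (by linarith)
      (by linarith)) (hL.trans h1)]

section QuarterPeriod

variable {ν s : ℝ} {ψ ψ' : ℝ → ℝ}

/-- First derivative test on a subinterval of `[0, π/2]` for the Bessel phase. -/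
theorem norm_integral_besselPhase_le_of_lower (hψ : ∀ x, HasDerivAt ψ (ψ' x) x)
    (hψc : Continuous ψ') (hψ1 : ∀ x, |ψ x| ≤ 1) (hV : ∫ x in (0)..(π / 2), |ψ' x| ≤ 1)
    (hs : 0 < s) {μ a b : ℝ} (hμ : 0 < μ) (ha : 0 ≤ a) (hab : a ≤ b) (hb : b ≤ π / 2)
    (hlow : ∀ ξ ∈ Set.Icc a b, μ ≤ |ν - 2 * s * sin ξ|) :
    ‖∫ ξ in a..b, (ψ ξ : ℂ) * Complex.exp ((ν * ξ + 2 * s * cos ξ : ℝ) * Complex.I)‖ ≤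
      5 / μ := by
  refine norm_integral_amplitude_mul_exp_le (φ' := fun ξ => ν - 2 * s * sin ξ)
    (φ'' := fun ξ => -(2 * s * cos ξ)) hab hμ (fun x => ?_) (fun x => ?_) hψ
    (by fun_prop) hψc (fun x hx => ?_) hlow (fun x _ => hψ1 x) ?_
  · have := ((hasDerivAt_id x).const_mul ν).add ((hasDerivAt_cos x).const_mul (2 * s))
    exact this.congr_deriv (by ring)
  · have := ((hasDerivAt_sin x).const_mul (2 * s)).const_sub ν
    exact this
  · have : 0 ≤ cos x := cos_nonneg_of_neg_pi_div_two_le_of_le (by linarith [hx.1, pi_pos])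
      (by linarith [hx.2])
    have : 0 ≤ 2 * s * cos x := by positivity
    linarith
  · refine le_trans (intervalIntegral.integral_mono_interval ha hab hb
      (Filter.Eventually.of_forall fun x => abs_nonneg _)
      (Continuous.intervalIntegrable (by fun_prop) _ _)) hV

/-- The Bessel-type integral over a quarter period decays like `(s (1 + |2s - |ν||))^{-1/4}`. -/
theorem norm_integral_besselPhase_le (hψ : ∀ x, HasDerivAt ψ (ψ' x) x)
    (hψc : Continuous ψ') (hψ1 : ∀ x, |ψ x| ≤ 1) (hV : ∫ x in (0)..(π / 2), |ψ' x| ≤ 1)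
    (hs : 0 < s) {m : ℝ} (hm : 0 < m) (hm4 : m ^ 4 = s * (1 + |2 * s - abs ν|)) :
    ‖∫ ξ in (0)..(π / 2), (ψ ξ : ℂ) * Complex.exp ((ν * ξ + 2 * s * cos ξ : ℝ) * Complex.I)‖ ≤
      20 / m := by
  have hpi := pi_pos
  have hpi4 := pi_le_four
  have hψcont : Continuous ψ := continuous_iff_continuousAt.2 fun x => (hψ x).continuousAt
  set f : ℝ → ℂ := fun ξ => (ψ ξ : ℂ) * Complex.exp ((ν * ξ + 2 * s * cos ξ : ℝ) * Complex.I)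
    with hf
  have hfc : Continuous f := by rw [hf]; fun_prop
  have hfi : ∀ a b, IntervalIntegrable f volume a b := fun a b => hfc.intervalIntegrable _ _
  have hf1 : ∀ ξ, ‖f ξ‖ ≤ 1 := fun ξ => by
    simp only [hf]
    rw [norm_mul, Complex.norm_exp_ofReal_mul_I, mul_one, Complex.norm_real]; exact hψ1 ξ
  have htriv : ∀ a b, a ≤ b → ‖∫ ξ in a..b, f ξ‖ ≤ b - a := fun a b hab => by
    simpa [abs_of_nonneg (sub_nonneg.2 hab)] using
      intervalIntegral.norm_integral_le_of_norm_le_const (a := a) (b := b) (C := 1)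
        (f := f) fun x _ => hf1 x
  have hsplit : ∀ α β : ℝ, 0 ≤ α → α ≤ β → β ≤ π / 2 →
      (α = 0 ∨ ∀ ξ ∈ Set.Icc 0 α, m ≤ |ν - 2 * s * sin ξ|) →
      (β = π / 2 ∨ ∀ ξ ∈ Set.Icc β (π / 2), m ≤ |ν - 2 * s * sin ξ|) →
      ‖∫ ξ in (0)..(π / 2), f ξ‖ ≤ 10 / m + (β - α) := by
    intro α β hα hαβ hβ h1 h2
    rw [← intervalIntegral.integral_add_adjacent_intervals (hfi 0 β) (hfi β _),
      ← intervalIntegral.integral_add_adjacent_intervals (hfi 0 α) (hfi α _)]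
    have b1 : ‖∫ ξ in (0)..α, f ξ‖ ≤ 5 / m := by
      rcases h1 with h | h
      · rw [h, intervalIntegral.integral_same, norm_zero]; positivity
      · exact norm_integral_besselPhase_le_of_lower hψ hψc hψ1 hV hs hm le_rfl hα
          (hαβ.trans hβ) h
    have b2 : ‖∫ ξ in β..(π / 2), f ξ‖ ≤ 5 / m := by
      rcases h2 with h | h
      · rw [h, intervalIntegral.integral_same, norm_zero]; positivity
      · exact norm_integral_besselPhase_le_of_lower hψ hψc hψ1 hV hs hm (hα.trans hαβ) hβ
          le_rfl h
    calc _ ≤ 5 / m + (β - α) + 5 / m :=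
          (norm_add_le _ _).trans (add_le_add ((norm_add_le _ _).trans
            (add_le_add b1 (htriv _ _ hαβ))) b2)
      _ = _ := by ring
  obtain ⟨α, β, hα, hαβ, hβ, h1, h2, h3, h4⟩ := exists_sublevel_interval ν hs hm
  have hI := hsplit α β hα hαβ hβ h1 h2
  obtain ⟨l1, l2⟩ := sin_sub_sin_lower hα hαβ hβ
  set D := |2 * s - abs ν| with hD
  have hD0 : 0 ≤ D := abs_nonneg _
  suffices h : ‖∫ ξ in (0)..(π / 2), f ξ‖ ≤ 10 / m + (β - α) → β - α ≤ 10 / m ∨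
      ‖∫ ξ in (0)..(π / 2), f ξ‖ ≤ 20 / m by
    rcases h hI with h | h
    · calc _ ≤ 10 / m + 10 / m := hI.trans (by linarith)
        _ = _ := by ring
    · exact h
  intro _
  rcases eq_or_lt_of_le hαβ with heq | hlt
  · left; rw [heq, sub_self]; positivity
  specialize h3 hlt
  rcases le_or_gt ((1 + D) ^ 3) s with hc | hc
  · -- transition region
    left
    have hm3 : m ^ 3 ≤ s := by
      have : (m ^ 3) ^ 4 ≤ s ^ 4 := by
        calc (m ^ 3) ^ 4 = (m ^ 4) ^ 3 := by ring
          _ = s ^ 3 * (1 + D) ^ 3 := by rw [hm4]; ring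
          _ ≤ s ^ 3 * s := by gcongr
          _ = s ^ 4 := by ring
      exact le_of_pow_le_pow_left₀ (by norm_num) hs.le this
    have h5 : m / s ≤ 1 / m ^ 2 := by
      rw [div_le_div_iff₀ hs (by positivity)]; nlinarith
    have h6 : ((β - α) / π) ^ 2 ≤ (1 / m) ^ 2 := by
      rw [one_div_pow]; nlinarith [sq_nonneg ((β - α) / π)]
    have h7 := le_of_pow_le_pow_left₀ (by norm_num) (by positivity) h6
    rw [div_le_iff₀ hpi] at h7
    calc β - α ≤ 1 / m * π := h7
      _ ≤ 1 / m * 10 := by gcongr; linarith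
      _ = 10 / m := by ring
  rcases lt_or_ge D 1 with hD1 | hD1
  · -- bounded `s`
    right
    have hs8 : s < 8 := hc.trans_le (by
      calc (1 + D) ^ 3 ≤ (1 + 1) ^ 3 := by gcongr
        _ = 8 := by norm_num)
    have hm2 : m ≤ 2 := by
      refine le_of_pow_le_pow_left₀ (n := 4) (by norm_num) (by norm_num) ?_
      rw [hm4]; nlinarith
    calc _ ≤ π / 2 - 0 := htriv _ _ (by positivity)
      _ ≤ 20 / 2 := by linarith
      _ ≤ 20 / m := by gcongr
  rcases lt_or_ge |ν| (2 * s) with hν | hν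
  · left
    have hDe : D = 2 * s - |ν| := abs_of_pos (by linarith)
    have hsa : 0 ≤ sin α := sin_nonneg_of_nonneg_of_le_pi hα (by linarith)
    have hcα : 0 ≤ cos α := cos_nonneg_of_neg_pi_div_two_le_of_le (by linarith) (by linarith)
    have hcos : m ^ 4 ≤ (2 * s * cos α) ^ 2 := by
      have e : cos α ^ 2 = 1 - sin α ^ 2 := by linarith [sin_sq_add_cos_sq α]
      have h5 : s * (1 + D) ≤ s * (2 * D) := by gcongr; linarith
      have h6 : D ≤ 2 * s * (1 - sin α) := by linarith
      have h7 : 0 ≤ 1 - sin α := by linarith [sin_le_one α]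
      rw [hm4, mul_pow, e]
      nlinarith [mul_nonneg (mul_nonneg hs.le hs.le) (mul_nonneg h7 hsa),
        mul_le_mul_of_nonneg_left h6 hs.le]
    have hcos' : m ^ 2 ≤ 2 * s * cos α := by
      refine le_of_pow_le_pow_left₀ (n := 2) (by norm_num) (by positivity) ?_
      calc (m ^ 2) ^ 2 = m ^ 4 := by ring
        _ ≤ _ := hcos
    have h8 : (β - α) / π * m ^ 2 ≤ 2 * m := by
      have hL : 0 ≤ (β - α) / π := div_nonneg (by linarith) hpi.le
      have h9 : (β - α) / π * cos α * s ≤ m := by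
        rw [← le_div_iff₀ hs]; exact l2.trans h3
      nlinarith [mul_le_mul_of_nonneg_left hcos' hL]
    have h10 : (β - α) / π ≤ 2 / m := by
      rw [le_div_iff₀ hm]; nlinarith
    rw [div_le_iff₀ hpi] at h10
    calc β - α ≤ 2 / m * π := h10
      _ = (2 * π) / m := by ring
      _ ≤ 10 / m := by gcongr; linarith
  · right
    have hDe : D = |ν| - 2 * s := by rw [hD, abs_of_nonpos (by linarith)]; ring
    have hlow : ∀ ξ ∈ Set.Icc 0 (π / 2), D ≤ |ν - 2 * s * sin ξ| := fun ξ _ => by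
      have h5 := abs_sub_abs_le_abs_sub ν (2 * s * sin ξ)
      have h6 : |2 * s * sin ξ| ≤ 2 * s := by
        rw [abs_mul, abs_of_pos (by positivity : 0 < 2 * s)]
        exact mul_le_of_le_one_right (by positivity) (abs_sin_le_one ξ)
      linarith
    have h7 := norm_integral_besselPhase_le_of_lower hψ hψc hψ1 hV hs (by linarith : 0 < D)
      le_rfl (by positivity : (0 : ℝ) ≤ π / 2) le_rfl hlow
    have h8 : m ≤ 1 + D := by
      refine le_of_pow_le_pow_left₀ (n := 4) (by norm_num) (by positivity) ?_
      rw [hm4]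
      calc s * (1 + D) ≤ (1 + D) ^ 3 * (1 + D) := by gcongr
        _ = _ := by ring
    calc _ ≤ 5 / D := h7
      _ ≤ 20 / m := by
        rw [div_le_div_iff₀ (by linarith) hm]; nlinarith

end QuarterPeriod

/-- The integrand of the damped Bessel-type integral. -/
def besselIntegrand (γ : ℂ) (ν s ξ : ℝ) : ℂ :=
  Complex.exp ((ν * ξ : ℝ) * Complex.I) * Complex.exp (-γ * (s * (2 * (1 - cos ξ)) : ℝ))

theorem continuous_besselIntegrand (γ : ℂ) (ν s : ℝ) : Continuous (besselIntegrand γ ν s) := by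
  unfold besselIntegrand; fun_prop

theorem norm_integral_besselIntegrand_half_le {ε s m : ℝ} (ν : ℝ) (hε : 0 ≤ ε) (hs : 0 < s)
    (hm : 0 < m) (hm4 : m ^ 4 = s * (1 + |2 * s - abs ν|)) :
    ‖∫ ξ in (0)..π, besselIntegrand (ε + Complex.I) ν s ξ‖ ≤ 40 / m := by
  have hpi := pi_pos
  have hc := continuous_besselIntegrand (ε + Complex.I) ν s
  have hd₁ : ∀ x, HasDerivAt (fun ξ => exp (-(2 * ε * s * (1 - cos ξ))))
      (-(2 * ε * s * sin x * exp (-(2 * ε * s * (1 - cos x))))) x := fun x => by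
    have := ((((hasDerivAt_cos x).const_sub 1).const_mul (2 * ε * s)).neg).exp
    exact this.congr_deriv (by simp only [Pi.neg_apply, neg_neg]; ring)
  have hd₂ : ∀ x, HasDerivAt (fun ξ => exp (-(2 * ε * s * (1 + cos ξ))))
      (2 * ε * s * sin x * exp (-(2 * ε * s * (1 + cos x)))) x := fun x => by
    have := ((((hasDerivAt_cos x).const_add 1).const_mul (2 * ε * s)).neg).exp
    exact this.congr_deriv (by simp only [Pi.neg_apply]; ring)
  have hle₁ : ∀ x : ℝ, exp (-(2 * ε * s * (1 - cos x))) ≤ 1 := fun x => by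
    rw [exp_le_one_iff, neg_nonpos]
    exact mul_nonneg (by positivity) (by linarith [cos_le_one x])
  have hle₂ : ∀ x : ℝ, exp (-(2 * ε * s * (1 + cos x))) ≤ 1 := fun x => by
    rw [exp_le_one_iff, neg_nonpos]
    exact mul_nonneg (by positivity) (by linarith [neg_one_le_cos x])
  have hsin : ∀ x ∈ Set.uIcc 0 (π / 2), 0 ≤ sin x := fun x hx => by
    rw [Set.uIcc_of_le (by positivity)] at hx
    exact sin_nonneg_of_nonneg_of_le_pi hx.1 (by linarith [hx.2])
  have hV₁ : ∫ x in (0)..(π / 2), |-(2 * ε * s * sin x * exp (-(2 * ε * s * (1 - cos x))))| ≤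
      1 := by
    rw [intervalIntegral.integral_congr
      (g := fun x => -(-(2 * ε * s * sin x * exp (-(2 * ε * s * (1 - cos x))))))
      (fun x hx => abs_of_nonpos (neg_nonpos.2 (by have := hsin x hx; positivity))),
      intervalIntegral.integral_neg, intervalIntegral.integral_eq_sub_of_hasDerivAt
        (fun x _ => hd₁ x) (Continuous.intervalIntegrable (by fun_prop) _ _)]
    have h1 := hle₁ 0
    have h2 := exp_pos (-(2 * ε * s * (1 - cos (π / 2))))
    linarith
  have hV₂ : ∫ x in (0)..(π / 2), |2 * ε * s * sin x * exp (-(2 * ε * s * (1 + cos x)))| ≤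
      1 := by
    rw [intervalIntegral.integral_congr
      (g := fun x => 2 * ε * s * sin x * exp (-(2 * ε * s * (1 + cos x))))
      (fun x hx => abs_of_nonneg (by have := hsin x hx; positivity)),
      intervalIntegral.integral_eq_sub_of_hasDerivAt
        (fun x _ => hd₂ x) (Continuous.intervalIntegrable (by fun_prop) _ _)]
    have h1 := hle₂ (π / 2)
    have h2 := exp_pos (-(2 * ε * s * (1 + cos 0)))
    linarith
  have B₁ := norm_integral_besselPhase_le (ν := ν) hd₁ (by fun_prop)
    (fun x => by rw [abs_of_pos (exp_pos _)]; exact hle₁ x) hV₁ hs hm hm4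
  have B₂ := norm_integral_besselPhase_le (ν := ν) hd₂ (by fun_prop)
    (fun x => by rw [abs_of_pos (exp_pos _)]; exact hle₂ x) hV₂ hs hm hm4
  have E₁ : ∫ ξ in (0)..(π / 2), besselIntegrand (ε + Complex.I) ν s ξ =
      Complex.exp ((-(2 * s) : ℝ) * Complex.I) *
      ∫ ξ in (0)..(π / 2), ((exp (-(2 * ε * s * (1 - cos ξ))) : ℝ) : ℂ) *
        Complex.exp ((ν * ξ + 2 * s * cos ξ : ℝ) * Complex.I) := by
    rw [← intervalIntegral.integral_const_mul]
    refine intervalIntegral.integral_congr fun ξ _ => ?_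
    simp only [besselIntegrand, Complex.ofReal_exp, ← Complex.exp_add]
    congr 1
    push_cast; ring
  have E₂ : ∫ ξ in (π / 2)..π, besselIntegrand (ε + Complex.I) ν s ξ =
      Complex.exp ((ν * π - 2 * s : ℝ) * Complex.I) * (starRingEnd ℂ)
      (∫ ξ in (0)..(π / 2), ((exp (-(2 * ε * s * (1 + cos ξ))) : ℝ) : ℂ) *
        Complex.exp ((ν * ξ + 2 * s * cos ξ : ℝ) * Complex.I)) := by
    have h0 := intervalIntegral.integral_comp_sub_left (a := 0) (b := π / 2)
      (besselIntegrand (ε + Complex.I) ν s) π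
    rw [sub_zero, show π - π / 2 = π / 2 by ring] at h0
    rw [← h0, intervalIntegral.integral_of_le (by positivity),
      intervalIntegral.integral_of_le (by positivity), ← integral_conj, ← integral_const_mul]
    refine integral_congr_ae (Filter.Eventually.of_forall fun ξ => ?_)
    simp only [besselIntegrand, ← Complex.exp_conj, Complex.ofReal_exp, ← Complex.exp_add,
      cos_pi_sub]
    congr 1
    simp only [map_add, map_mul, Complex.conj_ofReal, Complex.conj_I]
    push_cast; ring
  rw [← intervalIntegral.integral_add_adjacent_intervals
    (hc.intervalIntegrable 0 (π / 2)) (hc.intervalIntegrable _ _), E₁, E₂]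
  refine (norm_add_le _ _).trans ?_
  rw [norm_mul, norm_mul, Complex.norm_exp_ofReal_mul_I, Complex.norm_exp_ofReal_mul_I,
    Complex.norm_conj, one_mul, one_mul]
  calc _ ≤ 20 / m + 20 / m := add_le_add B₁ B₂
    _ = 40 / m := by ring

/-- Uniform decay of the damped Bessel-type integrals of integer order. -/
theorem norm_integral_besselIntegrand_pow_four_le {ε s : ℝ} (n : ℤ) (hε : 0 ≤ ε) (hs : 0 < s) :
    ‖∫ ξ in (0)..(2 * π), besselIntegrand (ε + Complex.I) n s ξ‖ ^ 4 ≤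
      80 ^ 4 / (s * (1 + |2 * s - abs (n : ℝ)|)) := by
  have hpi := pi_pos
  have hP : 0 < s * (1 + |2 * s - abs (n : ℝ)|) := by positivity
  obtain ⟨m, hm, hm4⟩ : ∃ m : ℝ, 0 < m ∧ m ^ 4 = s * (1 + |2 * s - abs (n : ℝ)|) := by
    refine ⟨√(√(s * (1 + |2 * s - abs (n : ℝ)|))), by positivity, ?_⟩
    rw [show (4 : ℕ) = 2 * 2 by norm_num, pow_mul, sq_sqrt (by positivity), sq_sqrt hP.le]
  have hc := continuous_besselIntegrand (ε + Complex.I) n s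
  have h1 := norm_integral_besselIntegrand_half_le n hε hs hm hm4
  have h2 := norm_integral_besselIntegrand_half_le (-n) hε hs hm (by rwa [abs_neg])
  have h3 : ∫ ξ in π..(2 * π), besselIntegrand (ε + Complex.I) n s ξ =
      ∫ ξ in (0)..π, besselIntegrand (ε + Complex.I) (-n) s ξ := by
    have h0 := intervalIntegral.integral_comp_sub_left (a := 0) (b := π)
      (besselIntegrand (ε + Complex.I) n s) (2 * π)
    rw [sub_zero, show 2 * π - π = π by ring] at h0
    rw [← h0]
    refine intervalIntegral.integral_congr fun ξ _ => ?_
    simp only [besselIntegrand, cos_two_pi_sub]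
    congr 1
    rw [Complex.exp_eq_exp_iff_exists_int]
    exact ⟨n, by push_cast; ring⟩
  have h4 : ‖∫ ξ in (0)..(2 * π), besselIntegrand (ε + Complex.I) n s ξ‖ ≤ 80 / m := by
    rw [← intervalIntegral.integral_add_adjacent_intervals
      (hc.intervalIntegrable 0 π) (hc.intervalIntegrable _ _), h3]
    calc _ ≤ 40 / m + 40 / m := (norm_add_le _ _).trans (add_le_add h1 h2)
      _ = 80 / m := by ring
  calc _ ≤ (80 / m) ^ 4 := by gcongr
    _ = _ := by rw [div_pow, hm4]

section SubordinationIdentity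

variable {γ : ℂ} {α β : ℝ}

theorem image_mul_sub_div_Ioi (hα : 0 < α) (hβ : 0 < β) :
    (fun u : ℝ => α * u - β / u) '' Set.Ioi 0 = Set.univ := by
  refine Set.eq_univ_of_forall fun v => ?_
  have hlt : |v| < √(v ^ 2 + 4 * α * β) := by
    rw [← sqrt_sq_eq_abs]
    exact sqrt_lt_sqrt (sq_nonneg _) (by nlinarith [mul_pos hα hβ])
  have hsq := sq_sqrt (by positivity : 0 ≤ v ^ 2 + 4 * α * β)
  have hpos : 0 < v + √(v ^ 2 + 4 * α * β) := by linarith [neg_abs_le v]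
  generalize √(v ^ 2 + 4 * α * β) = R at hsq hpos
  refine ⟨(v + R) / (2 * α), by simp only [Set.mem_Ioi]; positivity, ?_⟩
  have hR : β / ((v + R) / (2 * α)) = (R - v) / 2 := by
    field_simp
    linear_combination -hsq
  simp only [hR]
  field_simp
  ring

theorem image_div_Ioi {c : ℝ} (hc : 0 < c) : (fun u : ℝ => c / u) '' Set.Ioi 0 = Set.Ioi 0 := by
  ext v
  constructor
  · rintro ⟨u, hu, rfl⟩
    exact div_pos hc hu
  · intro hv
    have hv' : v ≠ 0 := ne_of_gt hv
    exact ⟨c / v, div_pos hc hv, by field_simp⟩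

/-- The Gaussian integral after the Cauchy–Schlömilch substitution `v = α u - β / u`. -/
theorem cauchySchlomilch_gaussian (hγ : 0 < γ.re) (hα : 0 < α) (hβ : 0 < β) :
    IntegrableOn (fun u : ℝ => ((α + β / u ^ 2 : ℝ) : ℂ) *
      Complex.exp (-γ * (α ^ 2 * u ^ 2 + β ^ 2 / u ^ 2 : ℝ))) (Set.Ioi 0) ∧
    ∫ u in Set.Ioi (0 : ℝ), ((α + β / u ^ 2 : ℝ) : ℂ) *
      Complex.exp (-γ * (α ^ 2 * u ^ 2 + β ^ 2 / u ^ 2 : ℝ)) =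
      (π / γ) ^ (1 / 2 : ℂ) * Complex.exp (-γ * (2 * α * β : ℝ)) := by
  have hd : ∀ x ∈ Set.Ioi (0 : ℝ), HasDerivWithinAt (fun u : ℝ => α * u - β / u)
      (α + β / x ^ 2) (Set.Ioi 0) x := fun x hx => by
    have hx' : x ≠ 0 := ne_of_gt hx
    have := ((hasDerivAt_id x).const_mul α).sub ((hasDerivAt_inv hx').const_mul β)
    refine HasDerivAt.hasDerivWithinAt (this.congr_deriv ?_)
    simp; field_simp
  have hinj : Set.InjOn (fun u : ℝ => α * u - β / u) (Set.Ioi 0) := by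
    intro x hx y hy hxy
    have hx' : 0 < x := hx
    have hy' : 0 < y := hy
    simp only at hxy
    have h : (x - y) * (α * x * y + β) = 0 := by
      field_simp at hxy
      linear_combination hxy
    rcases mul_eq_zero.1 h with h | h
    · linarith
    · exact absurd h (by positivity)
  have hEq : Set.EqOn (fun x : ℝ => |α + β / x ^ 2| •
      Complex.exp (-γ * ((α * x - β / x : ℝ) : ℂ) ^ 2))
      (fun u : ℝ => (((α + β / u ^ 2 : ℝ) : ℂ) *
        Complex.exp (-γ * (α ^ 2 * u ^ 2 + β ^ 2 / u ^ 2 : ℝ))) *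
        Complex.exp (γ * (2 * α * β : ℝ))) (Set.Ioi 0) := by
    intro x hx
    have hx' : 0 < x := hx
    have hxc : (x : ℂ) ≠ 0 := by exact_mod_cast hx'.ne'
    have e : -γ * ((α * x - β / x : ℝ) : ℂ) ^ 2 =
        -γ * (α ^ 2 * x ^ 2 + β ^ 2 / x ^ 2 : ℝ) + γ * (2 * α * β : ℝ) := by
      push_cast; field_simp; ring
    simp only
    rw [abs_of_pos (by positivity), Complex.real_smul, e, Complex.exp_add]
    ring
  have hunit : Complex.exp (γ * (2 * α * β : ℝ)) * Complex.exp (-γ * (2 * α * β : ℝ)) = 1 := by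
    rw [← Complex.exp_add]; simp
  constructor
  · have h1 := (integrableOn_image_iff_integrableOn_abs_deriv_smul measurableSet_Ioi hd hinj
      (fun v : ℝ => Complex.exp (-γ * (v : ℂ) ^ 2))).1
      (by rw [image_mul_sub_div_Ioi hα hβ, integrableOn_univ]
          exact integrable_cexp_neg_mul_sq hγ)
    have h2 := (h1.congr_fun hEq measurableSet_Ioi).mul_const
      (Complex.exp (-γ * (2 * α * β : ℝ)))
    refine IntegrableOn.congr_fun h2 (fun x _ => ?_) measurableSet_Ioi
    rw [mul_assoc _ (Complex.exp (γ * _)), hunit, mul_one]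
  · have h1 := integral_image_eq_integral_abs_deriv_smul measurableSet_Ioi hd hinj
      (fun v : ℝ => Complex.exp (-γ * (v : ℂ) ^ 2))
    rw [image_mul_sub_div_Ioi hα hβ, setIntegral_univ, integral_gaussian_complex hγ,
      setIntegral_congr_fun measurableSet_Ioi hEq, integral_mul_const] at h1
    rw [h1, mul_assoc, hunit, mul_one]

theorem norm_exp_neg_mul_ofReal (γ : ℂ) (x : ℝ) :
    ‖Complex.exp (-γ * (x : ℂ))‖ = exp (-(γ.re * x)) := by
  rw [Complex.norm_exp]; simp

theorem integrableOn_subordination (hγ : 0 < γ.re) (hα : 0 < α) (hβ : 0 < β) :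
    IntegrableOn (fun u : ℝ => Complex.exp (-γ * (α ^ 2 * u ^ 2 + β ^ 2 / u ^ 2 : ℝ)))
      (Set.Ioi 0) ∧
    IntegrableOn (fun u : ℝ => ((1 / u ^ 2 : ℝ) : ℂ) *
      Complex.exp (-γ * (α ^ 2 * u ^ 2 + β ^ 2 / u ^ 2 : ℝ))) (Set.Ioi 0) := by
  have h := (cauchySchlomilch_gaussian hγ hα hβ).1
  constructor
  · refine Integrable.mono' (h.norm.const_mul α⁻¹)
      (Measurable.aestronglyMeasurable (by fun_prop)) ?_
    refine (ae_restrict_iff' measurableSet_Ioi).2 (Filter.Eventually.of_forall fun u hu => ?_)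
    have hu' : 0 < u := hu
    rw [norm_mul, Complex.norm_real, norm_of_nonneg (by positivity), ← mul_assoc]
    refine le_mul_of_one_le_left (norm_nonneg _) ?_
    rw [mul_add, inv_mul_cancel₀ hα.ne']
    have : 0 ≤ α⁻¹ * (β / u ^ 2) := by positivity
    linarith
  · refine Integrable.mono' (h.norm.const_mul β⁻¹)
      (Measurable.aestronglyMeasurable (by fun_prop)) ?_
    refine (ae_restrict_iff' measurableSet_Ioi).2 (Filter.Eventually.of_forall fun u hu => ?_)
    have hu' : 0 < u := hu
    rw [norm_mul, norm_mul, Complex.norm_real, norm_of_nonneg (by positivity),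
      Complex.norm_real, norm_of_nonneg (by positivity), ← mul_assoc]
    refine mul_le_mul_of_nonneg_right ?_ (norm_nonneg _)
    rw [mul_add, ← mul_div_assoc, inv_mul_cancel₀ hβ.ne']
    have : 0 ≤ β⁻¹ * α := by positivity
    linarith

/-- Subordination of `exp (-2 γ α β)` to Gaussians, in two versions. -/
theorem integral_subordination (hγ : 0 < γ.re) (hα : 0 < α) (hβ : 0 < β) :
    2 * α * ∫ u in Set.Ioi (0 : ℝ), Complex.exp (-γ * (α ^ 2 * u ^ 2 + β ^ 2 / u ^ 2 : ℝ)) =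
      (π / γ) ^ (1 / 2 : ℂ) * Complex.exp (-γ * (2 * α * β : ℝ)) ∧
    2 * β * ∫ u in Set.Ioi (0 : ℝ), ((1 / u ^ 2 : ℝ) : ℂ) *
      Complex.exp (-γ * (α ^ 2 * u ^ 2 + β ^ 2 / u ^ 2 : ℝ)) =
      (π / γ) ^ (1 / 2 : ℂ) * Complex.exp (-γ * (2 * α * β : ℝ)) := by
  obtain ⟨hF, hG⟩ := integrableOn_subordination hγ hα hβ
  have hsum := (cauchySchlomilch_gaussian hγ hα hβ).2
  have hadd : ∫ u in Set.Ioi (0 : ℝ), ((α + β / u ^ 2 : ℝ) : ℂ) *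
      Complex.exp (-γ * (α ^ 2 * u ^ 2 + β ^ 2 / u ^ 2 : ℝ)) =
      α * (∫ u in Set.Ioi (0 : ℝ), Complex.exp (-γ * (α ^ 2 * u ^ 2 + β ^ 2 / u ^ 2 : ℝ))) +
      β * ∫ u in Set.Ioi (0 : ℝ), ((1 / u ^ 2 : ℝ) : ℂ) *
        Complex.exp (-γ * (α ^ 2 * u ^ 2 + β ^ 2 / u ^ 2 : ℝ)) := by
    rw [← integral_const_mul, ← integral_const_mul,
      ← integral_add (hF.const_mul _) (hG.const_mul _)]
    refine integral_congr_ae (Filter.Eventually.of_forall fun u => ?_)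
    push_cast; ring
  have hc : 0 < β / α := by positivity
  have hd : ∀ x ∈ Set.Ioi (0 : ℝ), HasDerivWithinAt (fun u : ℝ => β / α / u)
      (-(β / α / x ^ 2)) (Set.Ioi 0) x := fun x hx => by
    have hx' : x ≠ 0 := ne_of_gt hx
    have := (hasDerivAt_inv hx').const_mul (β / α)
    refine HasDerivAt.hasDerivWithinAt (this.congr_deriv ?_)
    field_simp
  have hinj : Set.InjOn (fun u : ℝ => β / α / u) (Set.Ioi 0) := by
    intro x hx y hy hxy
    have hx' : 0 < x := hx
    have hy' : 0 < y := hy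
    simp only at hxy
    field_simp at hxy
    exact hxy.symm
  have hsymm := integral_image_eq_integral_abs_deriv_smul measurableSet_Ioi hd hinj
    (fun u : ℝ => Complex.exp (-γ * (α ^ 2 * u ^ 2 + β ^ 2 / u ^ 2 : ℝ)))
  rw [image_div_Ioi hc] at hsymm
  have hsymm' : α * ∫ u in Set.Ioi (0 : ℝ),
      Complex.exp (-γ * (α ^ 2 * u ^ 2 + β ^ 2 / u ^ 2 : ℝ)) =
      β * ∫ u in Set.Ioi (0 : ℝ), ((1 / u ^ 2 : ℝ) : ℂ) *
        Complex.exp (-γ * (α ^ 2 * u ^ 2 + β ^ 2 / u ^ 2 : ℝ)) := by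
    rw [hsymm, ← integral_const_mul, ← integral_const_mul]
    refine setIntegral_congr_fun measurableSet_Ioi fun u hu => ?_
    have hu' : 0 < u := hu
    have hαc : (α : ℂ) ≠ 0 := by exact_mod_cast hα.ne'
    have e : α ^ 2 * (β / α / u) ^ 2 + β ^ 2 / (β / α / u) ^ 2 =
        α ^ 2 * u ^ 2 + β ^ 2 / u ^ 2 := by field_simp; ring
    rw [abs_neg, abs_of_pos (by positivity), Complex.real_smul, e]
    push_cast
    field_simp
  constructor
  · linear_combination hsum - hadd + hsymm'
  · linear_combination hsum - hadd - hsymm'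

end SubordinationIdentity

section NonstationaryRegion

variable {η η' η'' : ℝ → ℝ}

/-- The phase of the subordination formula. -/
def subPhase (t l u : ℝ) : ℝ := t * (l * u ^ 2 + 1 / (4 * u ^ 2))

theorem norm_exp_subPhase_le_one {γ : ℂ} {t l : ℝ} (hγ : 0 ≤ γ.re) (ht : 0 ≤ t) (hl : 0 ≤ l)
    (u : ℝ) : ‖Complex.exp (-γ * subPhase t l u)‖ ≤ 1 := by
  rw [norm_exp_neg_mul_ofReal, exp_le_one_iff, neg_nonpos]
  exact mul_nonneg hγ (by unfold subPhase; positivity)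

theorem integrableOn_exp_subPhase {γ : ℂ} {t l : ℝ} (hγ : 0 < γ.re) (ht : 0 < t) (hl : 0 < l) :
    IntegrableOn (fun u : ℝ => Complex.exp (-γ * subPhase t l u)) (Set.Ioi 0) ∧
    IntegrableOn (fun u : ℝ => ((1 / u ^ 2 : ℝ) : ℂ) * Complex.exp (-γ * subPhase t l u))
      (Set.Ioi 0) := by
  have h := integrableOn_subordination (α := √(t * l)) (β := √t / 2) hγ (by positivity)
    (by positivity)
  have e : ∀ u : ℝ, √(t * l) ^ 2 * u ^ 2 + (√t / 2) ^ 2 / u ^ 2 = subPhase t l u := fun u => by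
    rw [sq_sqrt (by positivity), div_pow, sq_sqrt ht.le, subPhase]
    field_simp
    ring
  simpa only [e] using h

/-- First coefficient of the twice integrated by parts amplitude. -/
def ibpFirst (η : ℝ → ℝ) (l u : ℝ) : ℝ := -2 * (u * η u) * (1 - 4 * l * u ^ 4)⁻¹

/-- Second coefficient of the twice integrated by parts amplitude. -/
def ibpSecond (η η' : ℝ → ℝ) (l u : ℝ) : ℝ :=
  4 * (u ^ 3 * (η u + u * η' u)) * (1 - 4 * l * u ^ 4)⁻¹ ^ 2 +
    64 * l * (u ^ 7 * η u) * (1 - 4 * l * u ^ 4)⁻¹ ^ 3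

/-- The remaining amplitude after two integrations by parts. -/
def ibpRemainder (η η' η'' : ℝ → ℝ) (l u : ℝ) : ℝ :=
  4 * (3 * u ^ 2 * (η u + u * η' u) + u ^ 3 * (2 * η' u + u * η'' u)) *
      (1 - 4 * l * u ^ 4)⁻¹ ^ 2 +
    (128 * l * u ^ 6 * (η u + u * η' u) + 64 * l * (7 * u ^ 6 * η u + u ^ 7 * η' u)) *
      (1 - 4 * l * u ^ 4)⁻¹ ^ 3 +
    3072 * l ^ 2 * u ^ 10 * η u * (1 - 4 * l * u ^ 4)⁻¹ ^ 4

theorem one_sub_four_mul_pos {l u : ℝ} (hl : l ≤ 17) (hu : u ∈ Set.Icc (0 : ℝ) (1 / 4)) :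
    0 < 1 - 4 * l * u ^ 4 := by
  have h1 : u ^ 4 ≤ (1 / 4) ^ 4 := by
    have := hu.1; have := hu.2; gcongr
  have h2 : 0 ≤ u ^ 4 := by positivity
  nlinarith

theorem hasDerivAt_ibpFirst {l u : ℝ} (hη : HasDerivAt η (η' u) u)
    (hu : 1 - 4 * l * u ^ 4 ≠ 0) :
    HasDerivAt (ibpFirst η l) (-2 * (η u + u * η' u) * (1 - 4 * l * u ^ 4)⁻¹ -
      32 * l * u ^ 4 * η u * (1 - 4 * l * u ^ 4)⁻¹ ^ 2) u := by
  have hD := (((hasDerivAt_pow 4 u).const_mul (4 * l)).const_sub 1).inv hu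
  have h := (((hasDerivAt_id u).mul hη).const_mul (-2)).mul hD
  refine h.congr_deriv ?_
  simp
  field_simp
  ring

theorem hasDerivAt_ibpSecond {l u : ℝ} (hη : HasDerivAt η (η' u) u)
    (hη' : HasDerivAt η' (η'' u) u) (hu : 1 - 4 * l * u ^ 4 ≠ 0) :
    HasDerivAt (ibpSecond η η' l) (ibpRemainder η η' η'' l u) u := by
  have hD := (((hasDerivAt_pow 4 u).const_mul (4 * l)).const_sub 1).inv hu
  have h1 := (((hasDerivAt_pow 3 u).mul (hη.add ((hasDerivAt_id u).mul hη'))).const_mul 4).mul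
    (hD.pow 2)
  have h2 := (((hasDerivAt_pow 7 u).mul hη).const_mul (64 * l)).mul (hD.pow 3)
  refine (h1.add h2).congr_deriv ?_
  simp [ibpRemainder]
  field_simp
  ring

theorem hasDerivAt_subPhase {t l u : ℝ} (hu : u ≠ 0) :
    HasDerivAt (subPhase t l) (t * (2 * l * u - 1 / (2 * u ^ 3))) u := by
  have h := (((hasDerivAt_pow 2 u).const_mul l).add
    ((((hasDerivAt_pow 2 u).const_mul 4).inv (by positivity)).const_mul 1)).const_mul t
  have e : subPhase t l = fun u => t * (l * u ^ 2 + 1 * (4 * u ^ 2)⁻¹) := by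
    ext u; simp [subPhase]
  rw [e]
  refine h.congr_deriv ?_
  push_cast
  field_simp
  ring

theorem deriv_subPhase_mul_ibpFirst {l u : ℝ} (hu : u ≠ 0) (hD : 1 - 4 * l * u ^ 4 ≠ 0) :
    (2 * l * u - 1 / (2 * u ^ 3)) * ibpFirst η l u = η u / u ^ 2 := by
  have e : 2 * l * u - 1 / (2 * u ^ 3) = -(1 - 4 * l * u ^ 4) / (2 * u ^ 3) := by
    field_simp
    ring
  rw [e, ibpFirst]
  generalize 1 - 4 * l * u ^ 4 = c at hD ⊢
  field_simp

theorem deriv_subPhase_mul_ibpSecond {l u : ℝ} (hu : u ≠ 0) (hD : 1 - 4 * l * u ^ 4 ≠ 0) :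
    (2 * l * u - 1 / (2 * u ^ 3)) * ibpSecond η η' l u =
      -2 * (η u + u * η' u) * (1 - 4 * l * u ^ 4)⁻¹ -
        32 * l * u ^ 4 * η u * (1 - 4 * l * u ^ 4)⁻¹ ^ 2 := by
  have e : 2 * l * u - 1 / (2 * u ^ 3) = -(1 - 4 * l * u ^ 4) / (2 * u ^ 3) := by
    field_simp
    ring
  rw [e, ibpSecond]
  generalize 1 - 4 * l * u ^ 4 = c at hD ⊢
  field_simp
  ring

/-- Away from the stationary point, two integrations by parts gain `t ^ (-2)`, uniformly in the
frequency parameter. -/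
theorem exists_norm_integral_subPhase_le (hη : ∀ u, HasDerivAt η (η' u) u)
    (hη' : ∀ u, HasDerivAt η' (η'' u) u) (hη'' : Continuous η'')
    (h0 : η (1 / 4) = 0) (h1 : η' (1 / 4) = 0) :
    ∃ C > 0, ∀ (γ : ℂ) (t l : ℝ), 0 < γ.re → 1 ≤ ‖γ‖ → 0 < t → l ∈ Set.Icc (1 : ℝ) 17 →
      ‖∫ u in (0)..(1 / 4 : ℝ), ((η u / u ^ 2 : ℝ) : ℂ) * Complex.exp (-γ * subPhase t l u)‖ ≤
        C / t ^ 2 := by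
  have hηc : Continuous η := continuous_iff_continuousAt.2 fun x => (hη x).continuousAt
  have hη'c : Continuous η' := continuous_iff_continuousAt.2 fun x => (hη' x).continuousAt
  have hcont : ContinuousOn (fun p : ℝ × ℝ => ibpRemainder η η' η'' p.1 p.2)
      (Set.Icc 1 17 ×ˢ Set.Icc 0 (1 / 4)) := by
    have hi : ContinuousOn (fun p : ℝ × ℝ => (1 - 4 * p.1 * p.2 ^ 4)⁻¹)
        (Set.Icc 1 17 ×ˢ Set.Icc 0 (1 / 4)) :=
      ContinuousOn.inv₀ (by fun_prop) fun p hp => (one_sub_four_mul_pos hp.1.2 hp.2).ne'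
    unfold ibpRemainder
    fun_prop
  obtain ⟨C, hC⟩ := (isCompact_Icc.prod isCompact_Icc).exists_bound_of_continuousOn hcont
  have hC0 : 0 ≤ C := (norm_nonneg _).trans (hC (1, 0) ⟨by norm_num, by norm_num⟩)
  refine ⟨C + 1, by positivity, fun γ t l hγ hγ1 ht hl => ?_⟩
  have hl0 : 0 < l := by linarith [hl.1]
  set E : ℝ → ℂ := fun u => Complex.exp (-γ * subPhase t l u) with hE
  have hE1 : ∀ u, ‖E u‖ ≤ 1 := norm_exp_subPhase_le_one hγ.le ht.le hl0.le
  set T : ℝ → ℂ := fun u => (γ * t * ibpFirst η l u + ibpSecond η η' l u) * E u with hT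
  have hne : ∀ u ∈ Set.Icc (0 : ℝ) (1 / 4), 1 - 4 * l * u ^ 4 ≠ 0 := fun u hu =>
    (one_sub_four_mul_pos hl.2 hu).ne'
  have hdA : ∀ u ∈ Set.Icc (0 : ℝ) (1 / 4), HasDerivAt
      (fun u => γ * t * (ibpFirst η l u : ℂ) + (ibpSecond η η' l u : ℂ))
      (γ * t * ((-2 * (η u + u * η' u) * (1 - 4 * l * u ^ 4)⁻¹ -
        32 * l * u ^ 4 * η u * (1 - 4 * l * u ^ 4)⁻¹ ^ 2 : ℝ) : ℂ) +
        (ibpRemainder η η' η'' l u : ℂ)) u := fun u hu =>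
    ((hasDerivAt_ibpFirst (hη u) (hne u hu)).ofReal_comp.const_mul _).add
      (hasDerivAt_ibpSecond (hη u) (hη' u) (hne u hu)).ofReal_comp
  have hdE : ∀ u : ℝ, u ≠ 0 → HasDerivAt E
      (E u * (-γ * ((t * (2 * l * u - 1 / (2 * u ^ 3)) : ℝ) : ℂ))) u := fun u hu =>
    ((hasDerivAt_subPhase hu).ofReal_comp.const_mul (-γ)).cexp
  have hdT : ∀ u ∈ Set.Ioo (0 : ℝ) (1 / 4), HasDerivAt T
      ((ibpRemainder η η' η'' l u : ℂ) * E u -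
        (γ * t) ^ 2 * (((η u / u ^ 2 : ℝ) : ℂ) * E u)) u := by
    intro u hu
    have hu' := Set.Ioo_subset_Icc_self hu
    refine ((hdA u hu').mul (hdE u hu.1.ne')).congr_deriv ?_
    rw [← deriv_subPhase_mul_ibpFirst hu.1.ne' (hne u hu'),
      ← deriv_subPhase_mul_ibpSecond hu.1.ne' (hne u hu')]
    generalize 2 * l * u - 1 / (2 * u ^ 3) = q
    push_cast
    ring
  have hsub : Set.Ioc (0 : ℝ) (1 / 4) ⊆ Set.Ioi 0 := fun x hx => hx.1
  obtain ⟨i1, i2⟩ := integrableOn_exp_subPhase hγ ht hl0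
  have j1 : IntegrableOn E (Set.Icc 0 (1 / 4)) :=
    (integrableOn_Icc_iff_integrableOn_Ioc (by simp)).2 (i1.mono_set hsub)
  have j2 : IntegrableOn (fun u : ℝ => ((1 / u ^ 2 : ℝ) : ℂ) * E u) (Set.Icc 0 (1 / 4)) :=
    (integrableOn_Icc_iff_integrableOn_Ioc (by simp)).2 (i2.mono_set hsub)
  have hRc : ContinuousOn (fun u => (ibpRemainder η η' η'' l u : ℂ)) (Set.Icc 0 (1 / 4)) :=
    Complex.continuous_ofReal.comp_continuousOn
      (hcont.comp (f := fun u : ℝ => (l, u)) (by fun_prop) fun u hu => ⟨hl, hu⟩)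
  have k1 : IntervalIntegrable (fun u => (ibpRemainder η η' η'' l u : ℂ) * E u) volume
      0 (1 / 4) := by
    rw [intervalIntegrable_iff_integrableOn_Icc_of_le (by norm_num)]
    exact j1.continuousOn_mul hRc isCompact_Icc
  have k2 : IntervalIntegrable (fun u => ((η u / u ^ 2 : ℝ) : ℂ) * E u) volume 0 (1 / 4) := by
    rw [intervalIntegrable_iff_integrableOn_Icc_of_le (by norm_num)]
    have := j2.continuousOn_mul (g := fun u => (η u : ℂ))
      (by fun_prop : Continuous fun u => (η u : ℂ)).continuousOn isCompact_Icc
    refine this.congr_fun (fun u _ => ?_) measurableSet_Icc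
    simp only
    push_cast
    ring
  have hlim0 : Filter.Tendsto T (nhdsWithin 0 (Set.Ioi 0)) (nhds 0) := by
    have hA := (hdA 0 ⟨le_rfl, by norm_num⟩).continuousAt.tendsto.norm
    have hA0 : ‖γ * t * (ibpFirst η l 0 : ℂ) + (ibpSecond η η' l 0 : ℂ)‖ = 0 := by
      simp [ibpFirst, ibpSecond]
    rw [hA0] at hA
    refine squeeze_zero_norm (fun u => ?_) (hA.mono_left nhdsWithin_le_nhds)
    rw [hT, norm_mul]
    exact mul_le_of_le_one_right (norm_nonneg _) (hE1 u)
  have hlim1 : Filter.Tendsto T (nhdsWithin (1 / 4) (Set.Iio (1 / 4))) (nhds 0) := by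
    have hA : Filter.Tendsto T (nhds (1 / 4)) (nhds (T (1 / 4))) :=
      ((hdA (1 / 4) ⟨by norm_num, le_rfl⟩).continuousAt.mul
        (hdE (1 / 4) (by norm_num)).continuousAt).tendsto
    have hA0 : T (1 / 4) = 0 := by
      simp only [hT, ibpFirst, ibpSecond, h0, h1]
      simp
    rw [hA0] at hA
    exact hA.mono_left nhdsWithin_le_nhds
  have hFTC := intervalIntegral.integral_eq_sub_of_hasDerivAt_of_tendsto (by norm_num) hdT
    (k1.sub (k2.const_mul _)) hlim0 hlim1
  rw [intervalIntegral.integral_sub k1 (k2.const_mul _), intervalIntegral.integral_const_mul,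
    sub_zero, sub_eq_zero] at hFTC
  have hR : ‖∫ u in (0)..(1 / 4 : ℝ), (ibpRemainder η η' η'' l u : ℂ) * E u‖ ≤ C := by
    have := intervalIntegral.norm_integral_le_of_norm_le_const (a := 0) (b := 1 / 4) (C := C)
      (f := fun u => (ibpRemainder η η' η'' l u : ℂ) * E u) fun u hu => by
        rw [Set.uIoc_of_le (by norm_num)] at hu
        rw [norm_mul, Complex.norm_real]
        exact (mul_le_of_le_one_right (norm_nonneg _) (hE1 u)).trans
          (hC (l, u) ⟨hl, Set.Ioc_subset_Icc_self hu⟩)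
    refine this.trans ?_
    norm_num
    linarith
  rw [hFTC, norm_mul, norm_pow, norm_mul, Complex.norm_real, norm_of_nonneg ht.le] at hR
  rw [le_div_iff₀ (by positivity)]
  have h2 : t ^ 2 ≤ (‖γ‖ * t) ^ 2 := by
    rw [mul_pow]; exact le_mul_of_one_le_left (by positivity) (one_le_pow₀ hγ1)
  calc _ ≤ ‖∫ u in (0)..(1 / 4 : ℝ), ((η u / u ^ 2 : ℝ) : ℂ) * E u‖ * (‖γ‖ * t) ^ 2 := by gcongr
    _ ≤ C := by rw [mul_comm]; exact hR
    _ ≤ C + 1 := by linarith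

end NonstationaryRegion

section Cutoff

open Polynomial in
/-- A polynomial equal to `1` to fifth order at `0` and vanishing to second order at `1 / 4`. -/
def cutoffPoly : ℝ[X] := 1 - C 6144 * X ^ 5 + C 20480 * X ^ 6

/-- The subordination weight `u ^ m / u ^ 2` with the singularity at `0` removed. -/
def farWeight (m : ℕ) (u : ℝ) : ℝ :=
  if u ≤ 1 / 4 then (u ^ m - (Polynomial.X ^ m * cutoffPoly).eval u) / u ^ 2 else u ^ m / u ^ 2

theorem measurable_farWeight (m : ℕ) : Measurable (farWeight m) := by
  refine Measurable.ite measurableSet_Iic ?_ ?_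
  · exact ((measurable_id.pow_const m).sub (Polynomial.continuous _).measurable).div
      (measurable_id.pow_const 2)
  · exact (measurable_id.pow_const m).div (measurable_id.pow_const 2)

theorem farWeight_mem_Icc {m : ℕ} (hm : m = 0 ∨ m = 2) {u : ℝ} (hu : 0 < u) :
    farWeight m u ∈ Set.Icc 0 (6144 * min (u ^ 3) 1) := by
  unfold farWeight
  split_ifs with h
  · have e : (u ^ m - (Polynomial.X ^ m * cutoffPoly).eval u) / u ^ 2 =
        u ^ m * (u ^ 3 * (6144 - 20480 * u)) := by
      simp only [cutoffPoly, Polynomial.eval_mul, Polynomial.eval_pow, Polynomial.eval_X,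
        Polynomial.eval_add, Polynomial.eval_sub, Polynomial.eval_one, Polynomial.eval_C]
      field_simp
      ring
    have h1 : u ^ m ≤ 1 := pow_le_one₀ hu.le (by linarith)
    have h3 : u ^ 3 ≤ 1 := pow_le_one₀ hu.le (by linarith)
    have h4 : 0 ≤ u ^ 3 * (6144 - 20480 * u) := mul_nonneg (by positivity) (by linarith)
    rw [e, min_eq_left h3]
    refine ⟨mul_nonneg (by positivity) h4, (mul_le_of_le_one_left h4 h1).trans ?_⟩
    rw [mul_comm]
    gcongr
    linarith
  · push Not at h
    refine ⟨by positivity, ?_⟩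
    have h3 : (1 / 4) ^ 3 ≤ u ^ 3 := by gcongr
    have h6 : 16 ≤ 6144 * min (u ^ 3) 1 := by
      rw [mul_min_of_nonneg _ _ (by norm_num), le_min_iff]
      constructor <;> linarith
    refine le_trans ?_ h6
    rw [div_le_iff₀ (by positivity)]
    rcases hm with rfl | rfl <;> nlinarith

theorem exists_norm_integral_sub_farWeight_le {m : ℕ} (hm : m = 0 ∨ m = 2) :
    ∃ C > 0, ∀ (γ : ℂ) (t l : ℝ), 0 < γ.re → 1 ≤ ‖γ‖ → 0 < t → l ∈ Set.Icc (1 : ℝ) 17 →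
      ‖(∫ u in Set.Ioi (0 : ℝ), ((u ^ m / u ^ 2 : ℝ) : ℂ) * Complex.exp (-γ * subPhase t l u)) -
        ∫ u in Set.Ioi (0 : ℝ), (farWeight m u : ℂ) * Complex.exp (-γ * subPhase t l u)‖ ≤
        C / t ^ 2 := by
  set p : Polynomial ℝ := Polynomial.X ^ m * cutoffPoly with hp
  obtain ⟨C, hC, H⟩ := exists_norm_integral_subPhase_le (η := fun u => p.eval u)
    (η' := fun u => p.derivative.eval u) (η'' := fun u => p.derivative.derivative.eval u)
    (fun u => p.hasDerivAt u) (fun u => p.derivative.hasDerivAt u)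
    (Polynomial.continuous _) (by simp [hp, cutoffPoly]; norm_num)
    (by simp [hp, cutoffPoly]; norm_num)
  refine ⟨C, hC, fun γ t l hγ hγ1 ht hl => ?_⟩
  have hl0 : 0 < l := by linarith [hl.1]
  obtain ⟨i1, i2⟩ := integrableOn_exp_subPhase hγ ht hl0
  have j1 : IntegrableOn (fun u : ℝ => ((u ^ m / u ^ 2 : ℝ) : ℂ) *
      Complex.exp (-γ * subPhase t l u)) (Set.Ioi 0) := by
    rcases hm with rfl | rfl
    · simpa using i2
    · refine i1.congr_fun (fun u hu => ?_) measurableSet_Ioi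
      have : (u : ℝ) ≠ 0 := (ne_of_gt hu)
      simp [this]
  have j2 : IntegrableOn (fun u : ℝ => (farWeight m u : ℂ) *
      Complex.exp (-γ * subPhase t l u)) (Set.Ioi 0) := by
    refine i1.bdd_mul (c := 6144)
      (Complex.measurable_ofReal.comp (measurable_farWeight m)).aestronglyMeasurable ?_
    refine (ae_restrict_iff' measurableSet_Ioi).2 (Filter.Eventually.of_forall fun u hu => ?_)
    have := farWeight_mem_Icc hm hu
    rw [Complex.norm_real, norm_of_nonneg this.1]
    exact this.2.trans (by linarith [min_le_right (u ^ 3) 1])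
  refine le_of_eq_of_le ?_ (H γ t l hγ hγ1 ht hl)
  rw [← integral_sub j1 j2, intervalIntegral.integral_of_le (by norm_num),
    ← integral_indicator measurableSet_Ioi, ← integral_indicator measurableSet_Ioc]
  congr 2 with u
  by_cases h0 : 0 < u
  · by_cases h1 : u ≤ 1 / 4
    · rw [Set.indicator_of_mem (show u ∈ Set.Ioi 0 from h0), Set.indicator_of_mem (show u ∈ Set.Ioc 0 (1 / 4) from ⟨h0, h1⟩), farWeight,
        if_pos h1, ← hp]
      push_cast
      ring
    · rw [Set.indicator_of_mem (show u ∈ Set.Ioi 0 from h0), Set.indicator_of_notMem (show u ∉ Set.Ioc 0 (1 / 4) from fun h => h1 h.2),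
        farWeight, if_neg h1, sub_self]
  · rw [Set.indicator_of_notMem (show u ∉ Set.Ioi 0 from h0), Set.indicator_of_notMem (show u ∉ Set.Ioc 0 (1 / 4) from fun h => h0 h.1)]

end Cutoff

section LogIntegral

/-- The integrable kernel `1 / (1 + |y|) - 1 / (1 + t + |y|)`. -/
def logKernel (t y : ℝ) : ℝ := t / ((1 + |y|) * (1 + t + |y|))

theorem logKernel_nonneg {t : ℝ} (ht : 0 ≤ t) (y : ℝ) : 0 ≤ logKernel t y := by
  unfold logKernel; positivity

theorem integral_logKernel {t : ℝ} (ht : 0 ≤ t) :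
    Integrable (logKernel t) ∧ ∫ y, logKernel t y = 2 * log (1 + t) := by
  have hd : ∀ y ∈ Set.Ioi (0 : ℝ), HasDerivAt (fun y => log (1 + y) - log (1 + t + y))
      (logKernel t y) y := fun y hy => by
    have hy' : 0 < y := hy
    have h1 := ((hasDerivAt_id y).const_add 1).log (by simp; positivity)
    have h2 := ((hasDerivAt_id y).const_add (1 + t)).log (by simp; positivity)
    refine (h1.sub h2).congr_deriv ?_
    have := abs_of_pos hy'
    simp only [logKernel, this, id]
    field_simp
    ring
  have hc : ContinuousWithinAt (fun y => log (1 + y) - log (1 + t + y)) (Set.Ici 0) 0 := by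
    refine ContinuousAt.continuousWithinAt ?_
    refine ContinuousAt.sub (ContinuousAt.log (by fun_prop) (by simp))
      (ContinuousAt.log (by fun_prop) (by positivity))
  have hlim : Filter.Tendsto (fun y => log (1 + y) - log (1 + t + y)) Filter.atTop (nhds 0) := by
    have h1 : Filter.Tendsto (fun y : ℝ => 1 - t * (1 + t + y)⁻¹) Filter.atTop
        (nhds (1 - t * 0)) :=
      ((tendsto_inv_atTop_zero.comp (Filter.tendsto_atTop_add_const_left _ _
        Filter.tendsto_id)).const_mul t).const_sub 1
    have h2 := ((continuousAt_log (by simp : (1 - t * 0 : ℝ) ≠ 0)).tendsto.comp h1)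
    simp only [mul_zero, sub_zero, log_one] at h2
    refine h2.congr' ?_
    filter_upwards [Filter.eventually_gt_atTop 0] with y hy
    rw [← log_div (by positivity) (by positivity)]
    simp only [Function.comp]
    congr 1
    field_simp
    ring
  have hnn : ∀ y ∈ Set.Ioi (0 : ℝ), 0 ≤ logKernel t y := fun y _ => logKernel_nonneg ht y
  have hi := integrableOn_Ioi_deriv_of_nonneg hc hd hnn hlim
  have hI := integral_Ioi_of_hasDerivAt_of_nonneg hc hd hnn hlim
  have habs : (fun y => logKernel t |y|) = logKernel t := by
    ext y; simp [logKernel]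
  refine ⟨?_, ?_⟩
  · have hneg : IntegrableOn (logKernel t) (Set.Iic 0) := by
      rw [integrableOn_Iic_iff_integrableOn_Iio, ← (Measure.measurePreserving_neg
        (volume : Measure ℝ)).integrableOn_comp_preimage (Homeomorph.neg ℝ).measurableEmbedding]
      have : logKernel t ∘ Neg.neg = logKernel t := by
        ext y; simp [logKernel]
      simpa [this] using hi
    rw [← integrableOn_univ, ← Set.Iic_union_Ioi (a := (0 : ℝ))]
    exact hneg.union hi
  · have := integral_comp_abs (f := logKernel t)
    rw [habs, hI] at this
    rw [this]
    simp

theorem setIntegral_logKernel_comp_le {t : ℝ} (ht : 0 < t) (n : ℝ) :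
    IntegrableOn (fun u => u * logKernel t (2 * (t * u ^ 2) - n)) (Set.Ioi 0) ∧
    ∫ u in Set.Ioi (0 : ℝ), u * logKernel t (2 * (t * u ^ 2) - n) ≤
      t⁻¹ * (2⁻¹ * log (1 + t)) := by
  obtain ⟨hi, hI⟩ := integral_logKernel ht.le
  have hd : ∀ u ∈ Set.Ioi (0 : ℝ), HasDerivWithinAt (fun u => 2 * (t * u ^ 2) - n)
      (4 * t * u) (Set.Ioi 0) u := fun u _ => by
    refine HasDerivAt.hasDerivWithinAt (HasDerivAt.congr_deriv
      ((((hasDerivAt_pow 2 u).const_mul t).const_mul 2).sub_const n) ?_)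
    push_cast
    ring
  have hinj : Set.InjOn (fun u : ℝ => 2 * (t * u ^ 2) - n) (Set.Ioi 0) := by
    intro a ha b hb hab
    have : t * a ^ 2 = t * b ^ 2 := by simp only at hab; linarith
    exact (pow_left_inj₀ (le_of_lt ha) (le_of_lt hb) two_ne_zero).1 (mul_left_cancel₀ ht.ne' this)
  have e : ∀ u ∈ Set.Ioi (0 : ℝ), |4 * t * u| • logKernel t (2 * (t * u ^ 2) - n) =
      4 * t * (u * logKernel t (2 * (t * u ^ 2) - n)) := fun u hu => by
    have hu' : 0 < u := hu
    rw [abs_of_pos (by positivity), smul_eq_mul]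
    ring
  have h1 := (integrableOn_image_iff_integrableOn_abs_deriv_smul measurableSet_Ioi hd hinj
    (logKernel t)).1 hi.integrableOn
  have h2 := integral_image_eq_integral_abs_deriv_smul measurableSet_Ioi hd hinj (logKernel t)
  rw [integrableOn_congr_fun e measurableSet_Ioi] at h1
  rw [setIntegral_congr_fun measurableSet_Ioi e, integral_const_mul] at h2
  have h3 : ∫ y in (fun u : ℝ => 2 * (t * u ^ 2) - n) '' Set.Ioi 0, logKernel t y ≤
      2 * log (1 + t) :=
    hI ▸ setIntegral_le_integral hi (Filter.Eventually.of_forall (logKernel_nonneg ht.le))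
  refine ⟨(integrable_const_mul_iff (by simp [ht.ne']) _).1 h1, ?_⟩
  rw [h2] at h3
  rw [inv_mul_eq_div, le_div_iff₀ ht]
  linarith

theorem setIntegral_min_div_le {t : ℝ} (ht : 1 ≤ t) (n : ℝ) :
    IntegrableOn (fun u : ℝ => min (u ^ 3) 1 / (t * u ^ 2 * (1 + |2 * (t * u ^ 2) - n|)))
      (Set.Ioi 0) ∧
    ∫ u in Set.Ioi (0 : ℝ), min (u ^ 3) 1 / (t * u ^ 2 * (1 + |2 * (t * u ^ 2) - n|)) ≤
      8 * log (2 + t) / t ^ 2 := by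
  have ht0 : 0 < t := by linarith
  obtain ⟨hi, hI⟩ := setIntegral_logKernel_comp_le ht0 n
  have hle : ∀ u ∈ Set.Ioi (0 : ℝ),
      min (u ^ 3) 1 / (t * u ^ 2 * (1 + |2 * (t * u ^ 2) - n|)) ≤
        t⁻¹ * (u * logKernel t (2 * (t * u ^ 2) - n)) + 2 * t⁻¹ ^ 2 * (1 + u ^ 2)⁻¹ := by
    intro u hu
    have hu' : 0 < u := hu
    set y := 2 * (t * u ^ 2) - n
    have hy : 0 ≤ |y| := abs_nonneg y
    have hk : (1 + |y|)⁻¹ ≤ logKernel t y + t⁻¹ := by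
      have : (1 + |y|)⁻¹ = logKernel t y + (1 + t + |y|)⁻¹ := by
        unfold logKernel
        field_simp
        ring
      rw [this]
      gcongr
      linarith
    have hm : min (u ^ 3) 1 / u ^ 2 ≤ u := by
      rw [div_le_iff₀ (by positivity)]
      exact (min_le_left _ _).trans_eq (by ring)
    have hm' : min (u ^ 3) 1 / u ^ 2 ≤ 2 * (1 + u ^ 2)⁻¹ := by
      rw [← div_eq_mul_inv, div_le_div_iff₀ (by positivity) (by positivity)]
      have h1 := min_le_right (u ^ 3) 1
      have h0 : 0 ≤ min (u ^ 3) 1 := by positivity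
      have h2 : min (u ^ 3) 1 ≤ u ^ 2 := by
        rcases le_total u 1 with h | h
        · exact (min_le_left _ _).trans (pow_le_pow_of_le_one hu'.le h (by norm_num))
        · exact h1.trans (one_le_pow₀ h)
      nlinarith [sq_nonneg u]
    have h0 : 0 ≤ min (u ^ 3) 1 / u ^ 2 := by positivity
    calc _ = t⁻¹ * (min (u ^ 3) 1 / u ^ 2 * (1 + |y|)⁻¹) := by field_simp
      _ ≤ t⁻¹ * (min (u ^ 3) 1 / u ^ 2 * (logKernel t y + t⁻¹)) := by gcongr
      _ = t⁻¹ * (min (u ^ 3) 1 / u ^ 2 * logKernel t y + min (u ^ 3) 1 / u ^ 2 * t⁻¹) := by ring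
      _ ≤ t⁻¹ * (u * logKernel t y + 2 * (1 + u ^ 2)⁻¹ * t⁻¹) := by
        have := logKernel_nonneg ht0.le y
        gcongr
      _ = _ := by ring
  have hsum : IntegrableOn (fun u : ℝ => t⁻¹ * (u * logKernel t (2 * (t * u ^ 2) - n)) +
      2 * t⁻¹ ^ 2 * (1 + u ^ 2)⁻¹) (Set.Ioi 0) :=
    (hi.const_mul _).add (integrable_inv_one_add_sq.integrableOn.const_mul _)
  have hnn : ∀ u ∈ Set.Ioi (0 : ℝ),
      0 ≤ min (u ^ 3) 1 / (t * u ^ 2 * (1 + |2 * (t * u ^ 2) - n|)) := fun u hu => by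
    have hu' : 0 < u := hu
    positivity
  have hf : IntegrableOn (fun u : ℝ => min (u ^ 3) 1 /
      (t * u ^ 2 * (1 + |2 * (t * u ^ 2) - n|))) (Set.Ioi 0) := by
    refine hsum.mono' (by fun_prop : Measurable _).aestronglyMeasurable ?_
    refine (ae_restrict_iff' measurableSet_Ioi).2 (Filter.Eventually.of_forall fun u hu => ?_)
    rw [norm_of_nonneg (hnn u hu)]
    exact hle u hu
  refine ⟨hf, (setIntegral_mono_on hf hsum measurableSet_Ioi hle).trans ?_⟩
  rw [integral_add (hi.const_mul _) (integrable_inv_one_add_sq.integrableOn.const_mul _),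
    integral_const_mul, integral_const_mul]
  have hpi : ∫ u in Set.Ioi (0 : ℝ), (1 + u ^ 2)⁻¹ ≤ π :=
    integral_univ_inv_one_add_sq ▸ setIntegral_le_integral integrable_inv_one_add_sq
      (Filter.Eventually.of_forall fun u => by positivity)
  have hlog : log (1 + t) ≤ log (2 + t) := log_le_log (by linarith) (by linarith)
  have hlog1 : 1 ≤ log (2 + t) := by
    rw [le_log_iff_exp_le (by linarith)]
    linarith [exp_one_lt_d9]
  have hpi4 := pi_lt_d2
  calc _ ≤ t⁻¹ * (t⁻¹ * (2⁻¹ * log (1 + t))) + 2 * t⁻¹ ^ 2 * π := by gcongr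
    _ = (2⁻¹ * log (1 + t) + 2 * π) / t ^ 2 := by field_simp
    _ ≤ _ := by
      gcongr
      linarith

end LogIntegral

section Cube

theorem continuous_omegaKG (d : ℕ) : Continuous (omegaKG d) := by
  unfold omegaKG; fun_prop

theorem omegaKG_sq (d : ℕ) (ξ : Fin d → ℝ) :
    omegaKG d ξ ^ 2 = 1 + ∑ j, 2 * (1 - cos (ξ j)) :=
  sq_sqrt (add_nonneg zero_le_one
    (Finset.sum_nonneg fun j _ => by linarith [cos_le_one (ξ j)]))

theorem one_le_omegaKG (d : ℕ) (ξ : Fin d → ℝ) : 1 ≤ omegaKG d ξ := by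
  rw [omegaKG, one_le_sqrt, le_add_iff_nonneg_right]
  exact Finset.sum_nonneg fun j _ => by linarith [cos_le_one (ξ j)]

theorem omegaKG_sq_mem_Icc (ξ : Fin 4 → ℝ) : omegaKG 4 ξ ^ 2 ∈ Set.Icc (1 : ℝ) 17 := by
  refine ⟨one_le_pow₀ (one_le_omegaKG 4 ξ), ?_⟩
  have : ∑ j, 2 * (1 - cos (ξ j)) ≤ ∑ _j : Fin 4, (4 : ℝ) :=
    Finset.sum_le_sum fun j _ => by linarith [neg_one_le_cos (ξ j)]
  rw [omegaKG_sq]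
  norm_num at this
  linarith

theorem volume_cube (d : ℕ) : volume (cube d) = ENNReal.ofReal (2 * π) ^ d := by
  simp [cube, Real.volume_Icc_pi]

theorem volume_cube_lt_top (d : ℕ) : volume (cube d) < ∞ := by
  rw [volume_cube]; exact ENNReal.pow_lt_top ENNReal.ofReal_lt_top

/-- The character `exp (i x · ξ)`. -/
def latticeChar {d : ℕ} (x : Fin d → ℤ) (ξ : Fin d → ℝ) : ℂ :=
  Complex.exp (((∑ j, (x j : ℝ) * ξ j : ℝ) : ℂ) * Complex.I)

theorem continuous_latticeChar {d : ℕ} (x : Fin d → ℤ) : Continuous (latticeChar x) := by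
  unfold latticeChar; fun_prop

theorem norm_latticeChar {d : ℕ} (x : Fin d → ℤ) (ξ : Fin d → ℝ) : ‖latticeChar x ξ‖ = 1 :=
  Complex.norm_exp_ofReal_mul_I _

theorem integral_cube_eq_prod {d : ℕ} (γ : ℂ) (s : ℝ) (x : Fin d → ℤ) :
    ∫ ξ in cube d, latticeChar x ξ * Complex.exp (-γ * (s * omegaKG d ξ ^ 2 : ℝ)) =
      Complex.exp (-γ * s) * ∏ j, ∫ ξ in (0)..(2 * π), besselIntegrand γ (x j) s ξ := by
  have e : ∀ ξ, latticeChar x ξ * Complex.exp (-γ * (s * omegaKG d ξ ^ 2 : ℝ)) =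
      Complex.exp (-γ * s) * ∏ j, besselIntegrand γ (x j) s (ξ j) := fun ξ => by
    simp only [besselIntegrand, latticeChar, ← Complex.exp_sum, ← Complex.exp_add, omegaKG_sq]
    congr 1
    push_cast
    simp only [Finset.mul_sum, mul_add, Finset.sum_add_distrib, ← Finset.sum_mul]
    ring
  simp_rw [e]
  have hc : cube d = Set.univ.pi fun _ => Set.Icc 0 (2 * π) := by
    rw [Set.pi_univ_Icc]; rfl
  rw [integral_const_mul, hc, volume_pi, Measure.restrict_pi_pi,
    integral_fintype_prod_eq_prod (fun j ξ => besselIntegrand γ (x j) s ξ)]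
  congr 2 with j
  rw [intervalIntegral.integral_of_le (by positivity), integral_Icc_eq_integral_Ioc]

theorem norm_integral_cube_le {ε s : ℝ} (hε : 0 ≤ ε) (hs : 0 < s) (x : Fin 4 → ℤ) :
    ‖∫ ξ in cube 4, latticeChar x ξ *
      Complex.exp (-(ε + Complex.I) * (s * omegaKG 4 ξ ^ 2 : ℝ))‖ ≤
      ∑ j, 80 ^ 4 / (s * (1 + |2 * s - abs (x j : ℝ)|)) := by
  have amgm : ∀ a b c d : ℝ, a * b * c * d ≤ a ^ 4 + b ^ 4 + c ^ 4 + d ^ 4 := fun a b c d => by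
    nlinarith [sq_nonneg (a * b - c * d), sq_nonneg (a ^ 2 - b ^ 2), sq_nonneg (c ^ 2 - d ^ 2),
      sq_nonneg (a * b), sq_nonneg (c * d), sq_nonneg (a ^ 2), sq_nonneg (b ^ 2),
      sq_nonneg (c ^ 2), sq_nonneg (d ^ 2)]
  rw [integral_cube_eq_prod, norm_mul, norm_exp_neg_mul_ofReal, norm_prod]
  have hexp : exp (-((ε + Complex.I : ℂ).re * s)) ≤ 1 := by
    rw [exp_le_one_iff]
    simp
    positivity
  refine (mul_le_of_le_one_left (by positivity) hexp).trans ?_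
  refine le_trans ?_ (Finset.sum_le_sum fun j _ =>
    norm_integral_besselIntegrand_pow_four_le (x j) hε hs)
  simp only [Fin.prod_univ_four, Fin.sum_univ_four]
  exact amgm _ _ _ _

theorem integrable_farWeight_prod {γ : ℂ} (hγ : 0 < γ.re) {m : ℕ} (hm : m = 0 ∨ m = 2) {t : ℝ}
    (ht : 0 < t) (x : Fin 4 → ℤ) :
    Integrable (fun p : (Fin 4 → ℝ) × ℝ => latticeChar x p.1 * ((farWeight m p.2 : ℂ) *
      Complex.exp (-γ * subPhase t (omegaKG 4 p.1 ^ 2) p.2)))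
      ((volume.restrict (cube 4)).prod (volume.restrict (Set.Ioi 0))) := by
  have : IsFiniteMeasure (volume.restrict (cube 4)) := ⟨by
    rw [Measure.restrict_apply_univ]; exact volume_cube_lt_top 4⟩
  have hg : Integrable (fun u : ℝ => 6144 * exp (-(γ.re * t) * u ^ 2))
      (volume.restrict (Set.Ioi 0)) :=
    ((integrable_exp_neg_mul_sq (by positivity)).const_mul _).integrableOn
  refine (hg.comp_snd (volume.restrict (cube 4))).mono' ?_ ?_
  · refine Measurable.aestronglyMeasurable ?_
    have h1 := (continuous_latticeChar x).measurable
    have h2 := (continuous_omegaKG 4).measurable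
    have h3 := measurable_farWeight m
    unfold subPhase
    fun_prop
  · rw [Measure.prod_restrict]
    have hm : MeasurableSet (cube 4 ×ˢ Set.Ioi (0 : ℝ)) := measurableSet_Icc.prod measurableSet_Ioi
    refine (ae_restrict_iff' hm).2 (Filter.Eventually.of_forall fun p hp => ?_)
    have hu : 0 < p.2 := hp.2
    have hw := farWeight_mem_Icc ‹_› hu
    rw [norm_mul, norm_latticeChar, one_mul, norm_mul, Complex.norm_real, norm_of_nonneg hw.1,
      norm_exp_neg_mul_ofReal]
    have hl := (omegaKG_sq_mem_Icc p.1).1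
    have hs : t * p.2 ^ 2 ≤ subPhase t (omegaKG 4 p.1 ^ 2) p.2 := by
      unfold subPhase
      have : 0 ≤ 1 / (4 * p.2 ^ 2) := by positivity
      gcongr
      nlinarith [sq_nonneg p.2]
    gcongr
    · exact hw.2.trans (by linarith [min_le_right (p.2 ^ 3) 1])
    · nlinarith

theorem norm_integral_farWeight_le {ε : ℝ} (hε : 0 < ε) {m : ℕ} (hm : m = 0 ∨ m = 2) {t : ℝ}
    (ht : 1 ≤ t) (x : Fin 4 → ℤ) :
    ‖∫ ξ in cube 4, latticeChar x ξ * ∫ u in Set.Ioi (0 : ℝ), (farWeight m u : ℂ) *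
      Complex.exp (-(ε + Complex.I) * subPhase t (omegaKG 4 ξ ^ 2) u)‖ ≤
      6144 * 80 ^ 4 * 32 * log (2 + t) / t ^ 2 := by
  have ht0 : 0 < t := by linarith
  have hint := integrable_farWeight_prod (γ := ε + Complex.I) (by simpa using hε) hm ht0 x
  simp_rw [← integral_const_mul]
  rw [integral_integral_swap hint]
  have hB : IntegrableOn (fun u : ℝ => 6144 * 80 ^ 4 * ∑ j, min (u ^ 3) 1 /
      (t * u ^ 2 * (1 + |2 * (t * u ^ 2) - abs (x j : ℝ)|))) (Set.Ioi 0) :=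
    (integrable_finsetSum _ fun j _ => (setIntegral_min_div_le ht _).1).const_mul _
  refine (norm_integral_le_of_norm_le hB ?_).trans ?_
  · refine (ae_restrict_iff' measurableSet_Ioi).2 (Filter.Eventually.of_forall fun u hu => ?_)
    have hu' : 0 < u := hu
    have hw := farWeight_mem_Icc hm hu'
    have e : ∀ ξ, latticeChar x ξ * ((farWeight m u : ℂ) *
        Complex.exp (-(ε + Complex.I) * subPhase t (omegaKG 4 ξ ^ 2) u)) =
        (farWeight m u * Complex.exp (-(ε + Complex.I) * (t / (4 * u ^ 2) : ℝ))) *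
        (latticeChar x ξ * Complex.exp (-(ε + Complex.I) *
          (t * u ^ 2 * omegaKG 4 ξ ^ 2 : ℝ))) := fun ξ => by
      have : subPhase t (omegaKG 4 ξ ^ 2) u = t / (4 * u ^ 2) + t * u ^ 2 * omegaKG 4 ξ ^ 2 := by
        unfold subPhase; ring
      rw [this, Complex.ofReal_add, mul_add, Complex.exp_add]
      ring
    simp_rw [e]
    have hexp : exp (-((ε + Complex.I : ℂ).re * (t / (4 * u ^ 2)))) ≤ 1 := by
      rw [exp_le_one_iff]
      simp
      positivity
    rw [integral_const_mul, norm_mul, norm_mul, Complex.norm_real, norm_of_nonneg hw.1,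
      norm_exp_neg_mul_ofReal]
    calc _ ≤ (6144 * min (u ^ 3) 1) * 1 *
          ∑ j, 80 ^ 4 / (t * u ^ 2 * (1 + |2 * (t * u ^ 2) - abs (x j : ℝ)|)) := by
          have := norm_integral_cube_le hε.le (by positivity : 0 < t * u ^ 2) x
          gcongr
          exact hw.2
      _ = _ := by
        rw [mul_one, Finset.mul_sum, Finset.mul_sum]
        refine Finset.sum_congr rfl fun j _ => ?_
        ring
  · rw [integral_const_mul, integral_finsetSum _ fun j _ => (setIntegral_min_div_le ht _).1]
    have := Finset.sum_le_sum fun (j : Fin 4) (_ : j ∈ Finset.univ) =>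
      (setIntegral_min_div_le ht (abs (x j : ℝ))).2
    rw [Finset.sum_const, Finset.card_univ, Fintype.card_fin] at this
    calc _ ≤ 6144 * 80 ^ 4 * (4 • (8 * log (2 + t) / t ^ 2)) := by gcongr
      _ = _ := by simp; ring

end Cube

section Decay

theorem one_le_norm_cpow_half {γ : ℂ} (h0 : 0 < ‖γ‖) (h : ‖γ‖ ≤ 2) :
    1 ≤ ‖((π : ℂ) / γ) ^ (1 / 2 : ℂ)‖ := by
  have e : (1 / 2 : ℂ) = ((1 / 2 : ℝ) : ℂ) := by push_cast; rfl
  rw [e, Complex.norm_cpow_real]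
  refine one_le_rpow ?_ (by norm_num)
  rw [norm_div, Complex.norm_real, norm_of_nonneg pi_pos.le, one_le_div h0]
  linarith [pi_gt_three]

/-- The amplitudes `1` and `ω⁻¹` correspond to the subordination weights `u ^ (-2)` and `1`. -/
theorem exists_subordination_of_amplitude {a : (Fin 4 → ℝ) → ℂ}
    (ha : a = (fun _ => 1) ∨ a = fun ξ => ((omegaKG 4 ξ : ℝ) : ℂ)⁻¹) :
    ∃ m : ℕ, (m = 0 ∨ m = 2) ∧ ∃ b : ℝ, b ∈ Set.Ioc 0 2 ∧ ∀ (γ : ℂ) (t : ℝ) (ξ : Fin 4 → ℝ),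
      0 < γ.re → 0 < t →
      ((π : ℂ) / γ) ^ (1 / 2 : ℂ) * (Complex.exp (-γ * (t * omegaKG 4 ξ : ℝ)) * a ξ) =
        (b * √t : ℝ) * ∫ u in Set.Ioi (0 : ℝ), ((u ^ m / u ^ 2 : ℝ) : ℂ) *
          Complex.exp (-γ * subPhase t (omegaKG 4 ξ ^ 2) u) := by
  have key : ∀ (γ : ℂ) (t : ℝ) (ξ : Fin 4 → ℝ), 0 < γ.re → 0 < t → _ := fun γ t ξ hγ ht =>
    integral_subordination (α := √t * omegaKG 4 ξ) (β := √t / 2) hγ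
      (mul_pos (by positivity) (by linarith [one_le_omegaKG 4 ξ])) (by positivity)
  have e : ∀ (t : ℝ) (ξ : Fin 4 → ℝ) (u : ℝ), 0 < t → (√t * omegaKG 4 ξ) ^ 2 * u ^ 2 +
      (√t / 2) ^ 2 / u ^ 2 = subPhase t (omegaKG 4 ξ ^ 2) u := fun t ξ u ht => by
    rw [mul_pow, div_pow, sq_sqrt ht.le, subPhase]
    field_simp
    ring
  have e' : ∀ (t : ℝ) (ξ : Fin 4 → ℝ), 0 < t →
      2 * (√t * omegaKG 4 ξ) * (√t / 2) = t * omegaKG 4 ξ := fun t ξ ht => by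
    linear_combination omegaKG 4 ξ * mul_self_sqrt ht.le
  rcases ha with rfl | rfl
  · refine ⟨0, Or.inl rfl, 1, by norm_num, fun γ t ξ hγ ht => ?_⟩
    have h := (key γ t ξ hγ ht).2
    simp_rw [e t ξ _ ht, e' t ξ ht] at h
    rw [mul_one, ← h]
    simp only [pow_zero]
    push_cast
    ring
  · refine ⟨2, Or.inr rfl, 2, by norm_num, fun γ t ξ hγ ht => ?_⟩
    have h := (key γ t ξ hγ ht).1
    simp_rw [e t ξ _ ht, e' t ξ ht] at h
    have hω : ((omegaKG 4 ξ : ℝ) : ℂ) ≠ 0 := by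
      exact_mod_cast (zero_lt_one.trans_le (one_le_omegaKG 4 ξ)).ne'
    have h1 : ∫ u in Set.Ioi (0 : ℝ), ((u ^ 2 / u ^ 2 : ℝ) : ℂ) *
        Complex.exp (-γ * subPhase t (omegaKG 4 ξ ^ 2) u) =
        ∫ u in Set.Ioi (0 : ℝ), Complex.exp (-γ * subPhase t (omegaKG 4 ξ ^ 2) u) := by
      refine setIntegral_congr_fun measurableSet_Ioi fun u hu => ?_
      have : u ≠ 0 := ne_of_gt hu
      simp [this]
    rw [h1, ← mul_assoc, ← h]
    push_cast
    field_simp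

theorem continuous_amplitude {a : (Fin 4 → ℝ) → ℂ}
    (ha : a = (fun _ => 1) ∨ a = fun ξ => ((omegaKG 4 ξ : ℝ) : ℂ)⁻¹) : Continuous a := by
  rcases ha with rfl | rfl
  · exact continuous_const
  · exact (Complex.continuous_ofReal.comp (continuous_omegaKG 4)).inv₀ fun ξ =>
      Complex.ofReal_ne_zero.2 (zero_lt_one.trans_le (one_le_omegaKG 4 ξ)).ne'

theorem norm_amplitude_le_one {a : (Fin 4 → ℝ) → ℂ}
    (ha : a = (fun _ => 1) ∨ a = fun ξ => ((omegaKG 4 ξ : ℝ) : ℂ)⁻¹) (ξ : Fin 4 → ℝ) :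
    ‖a ξ‖ ≤ 1 := by
  rcases ha with rfl | rfl
  · simp
  · have := one_le_omegaKG 4 ξ
    simp only [norm_inv, Complex.norm_real]
    exact inv_le_one_of_one_le₀ (this.trans (le_abs_self _))

theorem conj_amplitude {a : (Fin 4 → ℝ) → ℂ}
    (ha : a = (fun _ => 1) ∨ a = fun ξ => ((omegaKG 4 ξ : ℝ) : ℂ)⁻¹) (ξ : Fin 4 → ℝ) :
    (starRingEnd ℂ) (a ξ) = a ξ := by
  rcases ha with rfl | rfl <;> simp

/-- Dispersive decay for the propagator at complex time `(ε + i) t`, uniformly in `ε`. -/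
theorem exists_norm_integral_regularized_le {a : (Fin 4 → ℝ) → ℂ}
    (ha : a = (fun _ => 1) ∨ a = fun ξ => ((omegaKG 4 ξ : ℝ) : ℂ)⁻¹) :
    ∃ C > 0, ∀ (ε t : ℝ) (x : Fin 4 → ℤ), 0 < ε → ε ≤ 1 → 1 ≤ t →
      ‖∫ ξ in cube 4, latticeChar x ξ *
        (Complex.exp (-(ε + Complex.I) * (t * omegaKG 4 ξ : ℝ)) * a ξ)‖ ≤
        C * (√t * log (2 + t) / t ^ 2) := by
  obtain ⟨m, hm, b, hb, hsub⟩ := exists_subordination_of_amplitude ha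
  obtain ⟨C, hC, hnear⟩ := exists_norm_integral_sub_farWeight_le hm
  refine ⟨2 * (C * volume.real (cube 4) + 6144 * 80 ^ 4 * 32), by positivity,
    fun ε t x hε hε1 ht => ?_⟩
  have ht0 : 0 < t := by linarith
  set γ : ℂ := ε + Complex.I with hγ
  have hre : 0 < γ.re := by simpa [hγ] using hε
  have hγ1 : 1 ≤ ‖γ‖ := by
    have := Complex.abs_im_le_norm γ
    simpa [hγ] using this
  have hγ2 : ‖γ‖ ≤ 2 := by
    refine (norm_add_le _ _).trans ?_
    rw [Complex.norm_real, norm_of_nonneg hε.le, Complex.norm_I]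
    linarith
  set J : (Fin 4 → ℝ) → ℂ := fun ξ => ∫ u in Set.Ioi (0 : ℝ), ((u ^ m / u ^ 2 : ℝ) : ℂ) *
    Complex.exp (-γ * subPhase t (omegaKG 4 ξ ^ 2) u) with hJ
  set W : (Fin 4 → ℝ) → ℂ := fun ξ => ∫ u in Set.Ioi (0 : ℝ), (farWeight m u : ℂ) *
    Complex.exp (-γ * subPhase t (omegaKG 4 ξ ^ 2) u) with hW
  have hbt : 0 < b * √t := mul_pos hb.1 (by positivity)
  have hbt' : ((b * √t : ℝ) : ℂ) ≠ 0 := by exact_mod_cast hbt.ne'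
  have hJc : Continuous J := by
    have : J = fun ξ => ((b * √t : ℝ) : ℂ)⁻¹ * (((π : ℂ) / γ) ^ (1 / 2 : ℂ) *
        (Complex.exp (-γ * (t * omegaKG 4 ξ : ℝ)) * a ξ)) := by
      ext ξ
      rw [hsub γ t ξ hre ht0, inv_mul_cancel_left₀ hbt']
    rw [this]
    have h1 := continuous_amplitude ha
    have h2 := continuous_omegaKG 4
    fun_prop
  have hJi : IntegrableOn (fun ξ => latticeChar x ξ * J ξ) (cube 4) :=
    ((continuous_latticeChar x).mul hJc).continuousOn.integrableOn_compact isCompact_Icc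
  have hWi : IntegrableOn (fun ξ => latticeChar x ξ * W ξ) (cube 4) := by
    have := (integrable_farWeight_prod hre hm ht0 x).integral_prod_left
    simp only [integral_const_mul] at this
    exact this
  have hdiff : ‖∫ ξ in cube 4, (latticeChar x ξ * J ξ - latticeChar x ξ * W ξ)‖ ≤
      C / t ^ 2 * volume.real (cube 4) := by
    refine norm_setIntegral_le_of_norm_le_const (volume_cube_lt_top 4) fun ξ _ => ?_
    rw [← mul_sub, norm_mul, norm_latticeChar, one_mul]
    exact hnear γ t _ hre hγ1 ht0 (omegaKG_sq_mem_Icc ξ)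
  have hfar : ‖∫ ξ in cube 4, latticeChar x ξ * W ξ‖ ≤
      6144 * 80 ^ 4 * 32 * log (2 + t) / t ^ 2 := norm_integral_farWeight_le hε hm ht x
  have hlog1 : 1 ≤ log (2 + t) := by
    rw [le_log_iff_exp_le (by linarith)]
    linarith [exp_one_lt_d9]
  have heq : ((π : ℂ) / γ) ^ (1 / 2 : ℂ) * ∫ ξ in cube 4, latticeChar x ξ *
      (Complex.exp (-γ * (t * omegaKG 4 ξ : ℝ)) * a ξ) =
      (b * √t : ℝ) * ∫ ξ in cube 4, latticeChar x ξ * J ξ := by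
    rw [← integral_const_mul, ← integral_const_mul]
    refine integral_congr_ae (Filter.Eventually.of_forall fun ξ => ?_)
    simp only
    rw [mul_left_comm, hsub γ t ξ hre ht0, mul_left_comm]
  calc _ ≤ ‖((π : ℂ) / γ) ^ (1 / 2 : ℂ)‖ * ‖∫ ξ in cube 4, latticeChar x ξ *
        (Complex.exp (-γ * (t * omegaKG 4 ξ : ℝ)) * a ξ)‖ :=
        le_mul_of_one_le_left (norm_nonneg _) (one_le_norm_cpow_half (by linarith) hγ2)
    _ = b * √t * ‖(∫ ξ in cube 4, (latticeChar x ξ * J ξ - latticeChar x ξ * W ξ)) +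
        ∫ ξ in cube 4, latticeChar x ξ * W ξ‖ := by
      rw [← norm_mul, heq, norm_mul, Complex.norm_real, norm_of_nonneg hbt.le,
        integral_sub hJi hWi, sub_add_cancel]
    _ ≤ 2 * √t * (C / t ^ 2 * volume.real (cube 4) +
        6144 * 80 ^ 4 * 32 * log (2 + t) / t ^ 2) := by
      gcongr
      · exact hb.2
      · exact (norm_add_le _ _).trans (add_le_add hdiff hfar)
    _ ≤ 2 * √t * (C / t ^ 2 * volume.real (cube 4) * log (2 + t) +
        6144 * 80 ^ 4 * 32 * log (2 + t) / t ^ 2) := by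
      have : C / t ^ 2 * volume.real (cube 4) ≤ C / t ^ 2 * volume.real (cube 4) * log (2 + t) :=
        le_mul_of_one_le_right (by positivity) hlog1
      gcongr
    _ = _ := by ring

theorem oscInt_eq_latticeChar (a : (Fin 4 → ℝ) → ℂ) (t : ℝ) (x : Fin 4 → ℤ) :
    oscInt 4 a t x = ∫ ξ in cube 4, latticeChar x ξ *
      (Complex.exp (-(((0 : ℝ) : ℂ) + Complex.I) * (t * omegaKG 4 ξ : ℝ)) * a ξ) := by
  unfold oscInt latticeChar
  congr 1 with ξ
  rw [← mul_assoc, ← Complex.exp_add]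
  congr 2
  push_cast
  ring

theorem exists_norm_oscInt_le_of_one_le {a : (Fin 4 → ℝ) → ℂ}
    (ha : a = (fun _ => 1) ∨ a = fun ξ => ((omegaKG 4 ξ : ℝ) : ℂ)⁻¹) :
    ∃ C > 0, ∀ (t : ℝ) (x : Fin 4 → ℤ), 1 ≤ t →
      ‖oscInt 4 a t x‖ ≤ C * (√t * log (2 + t) / t ^ 2) := by
  obtain ⟨C, hC, H⟩ := exists_norm_integral_regularized_le ha
  refine ⟨C, hC, fun t x ht => ?_⟩
  have hcont : Continuous fun ε : ℝ => ∫ ξ in cube 4, latticeChar x ξ *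
      (Complex.exp (-((ε : ℂ) + Complex.I) * (t * omegaKG 4 ξ : ℝ)) * a ξ) := by
    refine continuous_parametric_integral_of_continuous ?_ isCompact_Icc
    have h1 := continuous_amplitude ha
    have h2 := continuous_omegaKG 4
    have h3 := continuous_latticeChar x
    unfold Function.uncurry
    fun_prop
  rw [oscInt_eq_latticeChar]
  refine le_of_tendsto ((hcont.norm.tendsto 0).mono_left
    (nhdsWithin_le_nhds (s := Set.Ioi 0))) ?_
  filter_upwards [Ioc_mem_nhdsGT zero_lt_one] with ε hε
  exact H ε t x hε.1 hε.2 ht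

theorem norm_oscInt_neg {a : (Fin 4 → ℝ) → ℂ}
    (ha : a = (fun _ => 1) ∨ a = fun ξ => ((omegaKG 4 ξ : ℝ) : ℂ)⁻¹) (t : ℝ) (x : Fin 4 → ℤ) :
    ‖oscInt 4 a t x‖ = ‖oscInt 4 a (-t) (-x)‖ := by
  rw [← RCLike.norm_conj (oscInt 4 a t x)]
  unfold oscInt
  rw [← integral_conj]
  congr 2 with ξ
  rw [map_mul, conj_amplitude ha, ← Complex.exp_conj]
  congr 2
  simp
  ring

theorem norm_oscInt_le_volume {a : (Fin 4 → ℝ) → ℂ}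
    (ha : a = (fun _ => 1) ∨ a = fun ξ => ((omegaKG 4 ξ : ℝ) : ℂ)⁻¹) (t : ℝ) (x : Fin 4 → ℤ) :
    ‖oscInt 4 a t x‖ ≤ volume.real (cube 4) := by
  rw [← one_mul (volume.real (cube 4))]
  refine norm_setIntegral_le_of_norm_le_const (volume_cube_lt_top 4) fun ξ _ => ?_
  rw [norm_mul, mul_comm Complex.I, Complex.norm_exp_ofReal_mul_I, one_mul]
  exact norm_amplitude_le_one ha ξ

theorem sqrt_div_sq_le_rpow {t : ℝ} (ht : 1 ≤ t) :
    √t / t ^ 2 ≤ 4 * (1 + t) ^ (-(3 : ℝ) / 2) := by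
  have ht0 : 0 < t := by linarith
  have e1 : √t / t ^ 2 = t ^ (-(3 : ℝ) / 2) := by
    rw [sqrt_eq_rpow, ← rpow_natCast t 2, ← rpow_sub ht0]
    norm_num
  have h1 : (2 * t) ^ (-(3 : ℝ) / 2) ≤ (1 + t) ^ (-(3 : ℝ) / 2) :=
    rpow_le_rpow_of_nonpos (by linarith) (by linarith) (by norm_num)
  have h2 : (4 : ℝ)⁻¹ ≤ 2 ^ (-(3 : ℝ) / 2) := by
    have : (4 : ℝ)⁻¹ = 2 ^ (-2 : ℝ) := by
      rw [rpow_neg (by norm_num)]; norm_num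
    rw [this]
    exact rpow_le_rpow_of_exponent_le (by norm_num) (by norm_num)
  rw [mul_rpow (by norm_num) ht0.le] at h1
  rw [e1]
  have h3 : 0 ≤ t ^ (-(3 : ℝ) / 2) := by positivity
  nlinarith

theorem le_rpow_mul_log {t : ℝ} (h0 : 0 ≤ t) (ht : t ≤ 1) :
    8⁻¹ ≤ (1 + t) ^ (-(3 : ℝ) / 2) * log (2 + t) := by
  have h1 : (4 : ℝ)⁻¹ ≤ (1 + t) ^ (-(3 : ℝ) / 2) := by
    have : (4 : ℝ)⁻¹ = 2 ^ (-2 : ℝ) := by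
      rw [rpow_neg (by norm_num)]; norm_num
    rw [this]
    exact (rpow_le_rpow_of_exponent_le (by norm_num) (by norm_num)).trans
      (rpow_le_rpow_of_nonpos (by linarith) (by linarith) (by norm_num))
  have h2 : (2 : ℝ)⁻¹ ≤ log (2 + t) := by
    have := log_le_log (by norm_num) (by linarith : (2 : ℝ) ≤ 2 + t)
    linarith [log_two_gt_d9]
  calc (8 : ℝ)⁻¹ = 4⁻¹ * 2⁻¹ := by norm_num
    _ ≤ _ := by gcongr

end Decay

/-- Sharp dispersive decay for the discrete Klein--Gordon equation in dimension `d = 4`: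
the `ℓ^∞` norm of the oscillatory integral decays like `(1+|t|)^{-3/2} log(2+|t|)`. -/
theorem dispersive_decay_d4
    (a : (Fin 4 → ℝ) → ℂ)
    (ha : a = (fun _ => 1) ∨ a = fun ξ => ((omegaKG 4 ξ : ℝ) : ℂ)⁻¹) :
    ∃ C > 0, ∀ (t : ℝ) (x : Fin 4 → ℤ),
      ‖oscInt 4 a t x‖ ≤ C * (1 + |t|) ^ (-(3 : ℝ)/2) * Real.log (2 + |t|) := by
  obtain ⟨C, hC, H⟩ := exists_norm_oscInt_le_of_one_le ha
  have hV : 0 ≤ volume.real (cube 4) := measureReal_nonneg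
  refine ⟨4 * C + 8 * volume.real (cube 4), by positivity, ?_⟩
  have main : ∀ (t : ℝ) (x : Fin 4 → ℤ), 0 ≤ t → ‖oscInt 4 a t x‖ ≤
      (4 * C + 8 * volume.real (cube 4)) * (1 + t) ^ (-(3 : ℝ) / 2) * log (2 + t) := by
    intro t x h0
    have hlog : 0 ≤ log (2 + t) := log_nonneg (by linarith)
    rcases le_total 1 t with ht | ht
    · calc _ ≤ C * (√t * log (2 + t) / t ^ 2) := H t x ht
        _ = C * (√t / t ^ 2) * log (2 + t) := by ring
        _ ≤ C * (4 * (1 + t) ^ (-(3 : ℝ) / 2)) * log (2 + t) := by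
          gcongr
          exact sqrt_div_sq_le_rpow ht
        _ = (4 * C) * (1 + t) ^ (-(3 : ℝ) / 2) * log (2 + t) := by ring
        _ ≤ _ := by
          gcongr
          linarith
    · calc _ ≤ 8 * volume.real (cube 4) * 8⁻¹ := by linarith [norm_oscInt_le_volume ha t x]
        _ ≤ (4 * C + 8 * volume.real (cube 4)) *
            ((1 + t) ^ (-(3 : ℝ) / 2) * log (2 + t)) := by
          gcongr
          · linarith
          · exact le_rpow_mul_log h0 ht
        _ = _ := by ring
  intro t x
  rcases le_total 0 t with ht | ht
  · rw [abs_of_nonneg ht]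
    exact main t x ht
  · rw [abs_of_nonpos ht, norm_oscInt_neg ha]
    exact main (-t) (-x) (by linarith)
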